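/- arXiv:2605.16124 — 5 statements merged into one kernel-verified Lean document; each statement's English description precedes it below -/
import Mathlib

section
/- Let A be a unital commutative ℝ-algebra, X(A) the set of ℝ-algebra homomorphisms A → ℝ with the topology of pointwise convergence, and L : A → ℝ linear with L(1)=1. Then L admits a representing positive Radon measure on the compact set K = {α ∈ X(A) : |α(a)| ≤ T_a for all a ∈ A} (for a family of positive reals (T_a)) if and only if L((T_a − a)^p (T_a + a)^q) ≥ 0 for all a ∈ A and p, q ∈ ℕ₀. -/
open MeasureTheory

variable {A : Type*} [CommRing A] [Algebra ℝ A]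

/-- The set of (underlying functions of) ℝ-algebra homomorphisms `A → ℝ`,
as a subset of `A → ℝ` with the topology of pointwise convergence. -/
def charSet (A : Type*) [CommRing A] [Algebra ℝ A] : Set (A → ℝ) :=
  {φ | ∃ ψ : A →ₐ[ℝ] ℝ, ⇑ψ = φ}


namespace M6

theorem cs (L : A →ₗ[ℝ] ℝ) (hp : ∀ b, 0 ≤ L (b * b)) (x y : A) :
    L (x * y) ^ 2 ≤ L (x * x) * L (y * y) := by
  have h : ∀ t : ℝ, 0 ≤ L (y * y) * (t * t) + (2 * L (x * y)) * t + L (x * x) := by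
    intro t
    have := hp (x + t • y)
    have e : (x + t • y) * (x + t • y) = x * x + (2 * t) • (x * y) + (t * t) • (y * y) := by
      simp only [Algebra.smul_def, map_mul, map_ofNat]; ring
    rw [e] at this
    simp only [map_add, map_smul, smul_eq_mul] at this
    linarith
  have := discrim_le_zero h
  unfold discrim at this
  nlinarith

theorem boot (L : A →ₗ[ℝ] ℝ) (hp : ∀ b, 0 ≤ L (b * b)) (a b : A) (T D : ℝ) (hT : 0 < T)
    (hD : ∀ n : ℕ, L (a ^ (2 * n)) ≤ D * T ^ (2 * n)) :
    L (a * a * (b * b)) ≤ T ^ 2 * L (b * b) := by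
  by_contra! hlt
  set m : ℕ → ℝ := fun k => L (a ^ (2 * k) * (b * b)) with hm
  have m0 : m 0 = L (b * b) := by simp [hm]
  have m1 : m 1 = L (a * a * (b * b)) := by simp [hm, pow_two]
  have mpos : ∀ k, 0 ≤ m k := by
    intro k
    have := hp (a ^ k * b)
    have e : a ^ k * b * (a ^ k * b) = a ^ (2 * k) * (b * b) := by ring
    rwa [e] at this
  have mlog : ∀ k, m (k + 1) ^ 2 ≤ m k * m (k + 2) := by
    intro k
    have := cs L hp (a ^ k * b) (a ^ (k + 2) * b)
    have e1 : a ^ k * b * (a ^ (k + 2) * b) = a ^ (2 * (k + 1)) * (b * b) := by ring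
    have e2 : a ^ k * b * (a ^ k * b) = a ^ (2 * k) * (b * b) := by ring
    have e3 : a ^ (k + 2) * b * (a ^ (k + 2) * b) = a ^ (2 * (k + 2)) * (b * b) := by ring
    rwa [e1, e2, e3] at this
  set E := L (b * b * (b * b)) with hE
  have hE0 : 0 ≤ E := hp _
  have mbd : ∀ k, m k ^ 2 ≤ D * E * (T ^ 2) ^ k * (T ^ 2) ^ k := by
    intro k
    have h := cs L hp (a ^ (2 * k)) (b * b)
    have e : a ^ (2 * k) * a ^ (2 * k) = a ^ (2 * (2 * k)) := by ring
    rw [e] at h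
    have h2 := mul_le_mul_of_nonneg_right (hD (2 * k)) hE0
    calc m k ^ 2 ≤ _ := h
      _ ≤ _ := h2
      _ = _ := by ring
  rw [← m0, ← m1] at hlt
  have m0p : 0 < m 0 := by
    rcases (mpos 0).lt_or_eq with h | h
    · exact h
    · have := mlog 0
      rw [← h] at this hlt
      nlinarith
  set r := m 1 / m 0 with hr
  have hrT : T ^ 2 < r := by rw [hr, lt_div_iff₀ m0p]; exact hlt
  have hT2 : 0 < T ^ 2 := by positivity
  have hr0 : 0 < r := hT2.trans hrT
  have key : ∀ k, 0 < m k ∧ r * m k ≤ m (k + 1) := by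
    intro k
    induction k with
    | zero => exact ⟨m0p, by rw [hr]; field_simp; simp⟩
    | succ k ih =>
      obtain ⟨h1, h2⟩ := ih
      have h3 : 0 < m (k + 1) := lt_of_lt_of_le (mul_pos hr0 h1) h2
      refine ⟨h3, ?_⟩
      have h4 := mlog k
      have h5 : r * m k * m (k + 1) ≤ m k * m (k + 2) := by nlinarith
      have : m k * (r * m (k + 1)) ≤ m k * m (k + 2) := by linarith
      exact le_of_mul_le_mul_left this h1
  have grow : ∀ k, m 0 * r ^ k ≤ m k := by
    intro k
    induction k with
    | zero => simp
    | succ k ih =>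
      calc m 0 * r ^ (k + 1) = r * (m 0 * r ^ k) := by ring
        _ ≤ r * m k := by gcongr
        _ ≤ _ := (key k).2
  set s := r / T ^ 2 with hs
  have hs1 : 1 < s := by rw [hs, lt_div_iff₀ hT2]; linarith
  obtain ⟨k, hk⟩ := pow_unbounded_of_one_lt (D * E / m 0 ^ 2) (one_lt_pow₀ hs1 two_ne_zero)
  have h6 := mbd k
  have h7 : (m 0 * r ^ k) ^ 2 ≤ m k ^ 2 := by
    have := grow k
    gcongr
  rw [div_lt_iff₀ (by positivity)] at hk
  have h8 : (m 0 * r ^ k) ^ 2 = ((s ^ 2) ^ k * m 0 ^ 2) * ((T ^ 2) ^ k * (T ^ 2) ^ k) := by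
    have : r = s * T ^ 2 := by rw [hs]; field_simp
    rw [this]; ring
  have h9 : 0 < (T ^ 2) ^ k * (T ^ 2) ^ k := by positivity
  nlinarith

/-- one-variable consequences -/
theorem powbd (L : A →ₗ[ℝ] ℝ) (u v : A) (huv : u + v = 1)
    (h : ∀ p q : ℕ, 0 ≤ L (v ^ p * u ^ q)) (k : ℕ) : ∀ p q : ℕ,
    0 ≤ L ((1 - (u - v) ^ k) * (v ^ p * u ^ q)) ∧ 0 ≤ L ((1 + (u - v) ^ k) * (v ^ p * u ^ q)) := by
  induction k with
  | zero =>
    intro p q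
    simp only [pow_zero, sub_self, zero_mul, map_zero, le_refl, true_and, add_mul, one_mul, map_add]
    have := h p q
    linarith
  | succ k ih =>
    intro p q
    constructor
    · have e : (1 - (u - v) ^ (k + 1)) * (v ^ p * u ^ q) =
          (1 + (u - v) ^ k) * (v ^ (p + 1) * u ^ q) + (1 - (u - v) ^ k) * (v ^ p * u ^ (q + 1)) := by
        linear_combination (-(v ^ p * u ^ q)) * huv
      rw [e, map_add]
      exact add_nonneg (ih _ _).2 (ih _ _).1
    · have e : (1 + (u - v) ^ (k + 1)) * (v ^ p * u ^ q) =
          (1 - (u - v) ^ k) * (v ^ (p + 1) * u ^ q) + (1 + (u - v) ^ k) * (v ^ p * u ^ (q + 1)) := by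
        linear_combination (-(v ^ p * u ^ q)) * huv
      rw [e, map_add]
      exact add_nonneg (ih _ _).1 (ih _ _).2

open Polynomial in
theorem bern (n : ℕ) : ∑ ν ∈ Finset.range (n + 1),
    (((2 * ν - n : ℝ)) ^ 2) • bernsteinPolynomial ℝ n ν =
    ((n : ℝ) ^ 2) • (2 * X - 1) ^ 2 + (4 * n : ℝ) • (X * (1 - X)) := by
  have hC2 : (C (2 : ℝ)) = 2 := map_ofNat C 2
  have hC4 : (C (4 : ℝ)) = 4 := map_ofNat C 4
  have h0 := bernsteinPolynomial.sum ℝ n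
  have h1 := bernsteinPolynomial.sum_smul ℝ n
  have h2 := bernsteinPolynomial.sum_mul_smul ℝ n
  have e : ∀ ν ∈ Finset.range (n + 1), (((2 * ν - n : ℝ)) ^ 2) • bernsteinPolynomial ℝ n ν =
      (4 : ℝ[X]) * ((ν * (ν - 1)) • bernsteinPolynomial ℝ n ν) +
      (4 - 4 * n : ℝ[X]) * (ν • bernsteinPolynomial ℝ n ν) + (n : ℝ[X]) ^ 2 * bernsteinPolynomial ℝ n ν := by
    intro ν _
    rcases ν with _ | ν
    · simp [smul_eq_C_mul]
    · simp only [smul_eq_C_mul, nsmul_eq_mul]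
      push_cast
      simp [hC2]
      ring
  rw [Finset.sum_congr rfl e, Finset.sum_add_distrib, Finset.sum_add_distrib, ← Finset.mul_sum,
    ← Finset.mul_sum, ← Finset.mul_sum, h0, h1, h2]
  rcases n with _ | n
  · simp
  · simp only [smul_eq_C_mul, nsmul_eq_mul]
    push_cast
    simp [hC4]
    ring

theorem sqpos (L : A →ₗ[ℝ] ℝ) (u v : A) (huv : u + v = 1)
    (h : ∀ p q : ℕ, 0 ≤ L (v ^ p * u ^ q)) : 0 ≤ L ((u - v) * (u - v)) := by
  have hv : v = 1 - u := by rw [← huv]; ring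
  have key : ∀ n : ℕ, 0 ≤ (n : ℝ) ^ 2 * L ((u - v) * (u - v)) + 4 * n * L (u * v) := by
    intro n
    have := congrArg (fun f => L (Polynomial.aeval u f)) (bern n)
    simp only [map_sum, map_smul, map_add, smul_eq_mul, map_mul, map_pow, map_sub, map_one,
      Polynomial.aeval_X, map_ofNat, bernsteinPolynomial, map_natCast] at this
    have e : (2 * u - 1) ^ 2 = (u - v) * (u - v) := by rw [hv]; ring
    rw [e, ← hv] at this
    rw [← this]
    refine Finset.sum_nonneg fun ν _ => mul_nonneg (sq_nonneg _) ?_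
    have e : ((n.choose ν : ℕ) : A) * u ^ ν * v ^ (n - ν) = (n.choose ν : ℝ) • (v ^ (n - ν) * u ^ ν) := by
      rw [Algebra.smul_def, map_natCast]; ring
    rw [e, map_smul, smul_eq_mul]
    exact mul_nonneg (by positivity) (h _ _)
  by_contra! hneg
  obtain ⟨n, hn⟩ := exists_nat_gt (4 * L (u * v) / (- L ((u - v) * (u - v))))
  have h0 := h 1 1
  rw [pow_one, pow_one, mul_comm] at h0
  have hn0 : (0 : ℝ) < n := lt_of_le_of_lt (div_nonneg (by linarith) (by linarith)) hn
  rw [div_lt_iff₀ (by linarith)] at hn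
  have := key n
  nlinarith

/-- The compact convex set of normalised bounded positive functionals. -/
def S (T : A → ℝ) : Set (A → ℝ) :=
  {f | (∀ a b, f (a + b) = f a + f b) ∧ (∀ (c : ℝ) a, f (c • a) = c * f a) ∧ f 1 = 1 ∧
    (∀ b, 0 ≤ f (b * b)) ∧ ∀ (a : A) (n : ℕ), f (a ^ (2 * n)) ≤ T a ^ (2 * n)}

theorem S_lin {T : A → ℝ} {f : A → ℝ} (hf : f ∈ S T) : ∃ L : A →ₗ[ℝ] ℝ, ⇑L = f :=
  ⟨{ toFun := f, map_add' := hf.1, map_smul' := fun c a => by simpa using hf.2.1 c a }, rfl⟩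

theorem S_abs {T : A → ℝ} (hT : ∀ a, 0 < T a) {f : A → ℝ} (hf : f ∈ S T) (a : A) :
    |f a| ≤ T a := by
  obtain ⟨L, rfl⟩ := S_lin hf
  obtain ⟨-, -, h1, hp, hb⟩ := hf
  have h := cs L hp 1 a
  have h2 := hb a 1
  rw [mul_one, h1, one_mul, one_mul, ← pow_two a] at h
  rw [mul_one] at h2
  exact abs_le_of_sq_le_sq (h.trans h2) (hT a).le

theorem S_convex (T : A → ℝ) : Convex ℝ (S T) := by
  rintro f ⟨f1, f2, f3, f4, f5⟩ g ⟨g1, g2, g3, g4, g5⟩ s t hs ht hst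
  refine ⟨fun a b => ?_, fun c a => ?_, ?_, fun b => ?_, fun a n => ?_⟩ <;>
    simp only [Pi.add_apply, Pi.smul_apply, smul_eq_mul]
  · rw [f1, g1]; ring
  · rw [f2, g2]; ring
  · rw [f3, g3]; linarith
  · exact add_nonneg (mul_nonneg hs (f4 b)) (mul_nonneg ht (g4 b))
  · calc _ ≤ s * T a ^ (2 * n) + t * T a ^ (2 * n) :=
        add_le_add (mul_le_mul_of_nonneg_left (f5 a n) hs) (mul_le_mul_of_nonneg_left (g5 a n) ht)
      _ = T a ^ (2 * n) := by rw [← add_mul, hst, one_mul]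

theorem S_compact (T : A → ℝ) (hT : ∀ a, 0 < T a) : IsCompact (S T) := by
  have hc : IsCompact (Set.univ.pi fun a : A => Set.Icc (-T a) (T a)) :=
    isCompact_univ_pi fun a => isCompact_Icc
  refine hc.of_isClosed_subset ?_ ?_
  · simp only [S, Set.ofPred_and, Set.ofPred_forall]
    refine IsClosed.inter ?_ (IsClosed.inter ?_ (IsClosed.inter ?_ (IsClosed.inter ?_ ?_)))
    · exact isClosed_iInter fun a => isClosed_iInter fun b =>
        isClosed_eq (by fun_prop) (by fun_prop)
    · exact isClosed_iInter fun a => isClosed_iInter fun b =>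
        isClosed_eq (by fun_prop) (by fun_prop)
    · exact isClosed_eq (by fun_prop) (by fun_prop)
    · exact isClosed_iInter fun b => isClosed_le (by fun_prop) (by fun_prop)
    · exact isClosed_iInter fun a => isClosed_iInter fun b =>
        isClosed_le (by fun_prop) (by fun_prop)
  · intro f hf a _
    exact abs_le.1 (S_abs hT hf a)

theorem S_mul {T : A → ℝ} (hT : ∀ a, 0 < T a) (L : A →ₗ[ℝ] ℝ) (hL : ⇑L ∈ S T) (w : A)
    (h0 : ∀ b, 0 ≤ L (w * (b * b))) (h1 : ∀ b, L (w * (b * b)) ≤ L (b * b)) (hw : 0 < L w) :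
    (fun x => (L w)⁻¹ * L (w * x)) ∈ S T := by
  obtain ⟨M, hM⟩ : ∃ M : A →ₗ[ℝ] ℝ, ∀ x, M x = (L w)⁻¹ * L (w * x) :=
    ⟨(L w)⁻¹ • (L ∘ₗ LinearMap.mulLeft ℝ w), fun x => by simp⟩
  have e : (fun x => (L w)⁻¹ * L (w * x)) = ⇑M := by ext x; rw [hM]
  rw [e]
  have hp : ∀ b, 0 ≤ M (b * b) := fun b => by
    rw [hM]; exact mul_nonneg (inv_nonneg.2 hw.le) (h0 b)
  have hM1 : M 1 = 1 := by rw [hM, mul_one, inv_mul_cancel₀ hw.ne']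
  refine ⟨map_add M, fun c a => by simp, hM1, hp, fun a n => ?_⟩
  have hb : ∀ n : ℕ, M (a ^ (2 * n)) ≤ (L w)⁻¹ * T a ^ (2 * n) := by
    intro n
    rw [hM]
    refine mul_le_mul_of_nonneg_left ?_ (inv_nonneg.2 hw.le)
    have e : a ^ (2 * n) = a ^ n * a ^ n := by ring
    have := hL.2.2.2.2 a n
    rw [e] at this ⊢
    exact (h1 _).trans this
  induction n with
  | zero => simp [hM1]
  | succ n ih =>
    have := boot M hp a (a ^ n) (T a) _ (hT a) hb
    have e1 : a * a * (a ^ n * a ^ n) = a ^ (2 * (n + 1)) := by ring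
    have e2 : a ^ n * a ^ n = a ^ (2 * n) := by ring
    rw [e1, e2] at this
    have h3 : 0 < T a ^ 2 := pow_pos (hT a) 2
    calc _ ≤ _ := this
      _ ≤ T a ^ 2 * T a ^ (2 * n) := by gcongr
      _ = _ := by ring

theorem S_ext {T : A → ℝ} (hT : ∀ a, 0 < T a) (L : A →ₗ[ℝ] ℝ)
    (hL : ⇑L ∈ (S T).extremePoints ℝ) (a x : A) : L (a * x) = L a * L x := by
  obtain ⟨hS, hE⟩ := hL
  have hS' := hS
  obtain ⟨-, -, h1, hp, hb⟩ := hS'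
  have hTa := hT a
  set c : ℝ := 1 / (4 * T a) with hc
  have hcT : c * T a = 1 / 4 := by rw [hc]; field_simp
  have hc0 : 0 < c := by rw [hc]; positivity
  set u : A := (1 / 2 : ℝ) • 1 + c • a with hu
  set v : A := (1 / 2 : ℝ) • 1 - c • a with hv
  have Lu : ∀ x, L (u * x) = 1 / 2 * L x + c * L (a * x) := by
    intro x; rw [hu, add_mul, smul_mul_assoc, smul_mul_assoc, one_mul]; simp
  have Lv : ∀ x, L (v * x) = 1 / 2 * L x - c * L (a * x) := by
    intro x; rw [hv, sub_mul, smul_mul_assoc, smul_mul_assoc, one_mul]; simp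
  have hbd : ∀ b, |c * L (a * (b * b))| ≤ 1 / 4 * L (b * b) := by
    intro b
    have hbo := boot L hp a b (T a) 1 hTa (fun n => by rw [one_mul]; exact hb a n)
    have h := cs L hp (a * b) b
    have e1 : a * b * b = a * (b * b) := by ring
    have e2 : a * b * (a * b) = a * a * (b * b) := by ring
    rw [e1, e2] at h
    have h2 : |L (a * (b * b))| ≤ T a * L (b * b) := by
      refine abs_le_of_sq_le_sq ?_ (mul_nonneg hTa.le (hp b))
      nlinarith [mul_le_mul_of_nonneg_right hbo (hp b)]
    rw [abs_mul, abs_of_pos hc0, ← hcT, mul_assoc]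
    exact mul_le_mul_of_nonneg_left h2 hc0.le
  have hb1 := hbd 1
  simp only [mul_one, h1] at hb1
  have Lu1 := Lu 1
  have Lv1 := Lv 1
  rw [mul_one, mul_one, h1] at Lu1 Lv1
  have hup : 0 < L u := by rw [Lu1]; linarith [(abs_le.1 hb1).1]
  have hvp : 0 < L v := by rw [Lv1]; linarith [(abs_le.1 hb1).2]
  have mu := S_mul hT L hS u
    (fun b => by rw [Lu]; linarith [(abs_le.1 (hbd b)).1, hp b])
    (fun b => by rw [Lu]; linarith [(abs_le.1 (hbd b)).2, hp b]) hup
  have mv := S_mul hT L hS v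
    (fun b => by rw [Lv]; linarith [(abs_le.1 (hbd b)).2, hp b])
    (fun b => by rw [Lv]; linarith [(abs_le.1 (hbd b)).1, hp b]) hvp
  have key := hE mu mv ⟨L u, L v, hup, hvp, by rw [Lu1, Lv1]; ring, by
    ext x
    simp only [Pi.add_apply, Pi.smul_apply, smul_eq_mul]
    rw [mul_inv_cancel_left₀ hup.ne', mul_inv_cancel_left₀ hvp.ne', Lu, Lv]; ring⟩
  have kx := congrFun key x
  rw [inv_mul_eq_iff_eq_mul₀ hup.ne', Lu, Lu1] at kx
  have : c * (L (a * x) - L a * L x) = 0 := by linarith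
  rcases mul_eq_zero.1 this with h | h
  · exact absurd h hc0.ne'
  · linarith

theorem S_nonneg {T : A → ℝ} (hT : ∀ a, 0 < T a) (f : A → ℝ) (hf : f ∈ S T) (a : A)
    (ha : ∀ φ : A →ₐ[ℝ] ℝ, (∀ b, |φ b| ≤ T b) → 0 ≤ φ a) : 0 ≤ f a := by
  rw [← closure_convexHull_extremePoints (S_compact T hT) (S_convex T)] at hf
  have hcl : IsClosed {g : A → ℝ | 0 ≤ g a} := isClosed_le (by fun_prop) (by fun_prop)
  have hcv : Convex ℝ {g : A → ℝ | 0 ≤ g a} := by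
    intro g hg k hk s t hs ht _
    exact add_nonneg (mul_nonneg hs hg) (mul_nonneg ht hk)
  refine closure_minimal (convexHull_min ?_ hcv) hcl hf
  intro g hg
  obtain ⟨L, rfl⟩ := S_lin hg.1
  exact ha (AlgHom.ofLinearMap L hg.1.2.2.1 (S_ext hT L hg)) (S_abs hT hg.1)

open MeasureTheory CompactlySupportedContinuousMap CompactlySupported in
theorem repr {X : Type*} [TopologicalSpace X] [CompactSpace X] [T2Space X]
    [MeasurableSpace X] [BorelSpace X] (Φ : A →ₗ[ℝ] C(X, ℝ)) (hΦ : Φ 1 = 1) (L : A →ₗ[ℝ] ℝ)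
    (hL : ∀ a, 0 ≤ Φ a → 0 ≤ L a) :
    ∃ μ : Measure X, IsFiniteMeasure μ ∧ ∀ a, L a = ∫ x, Φ a x ∂μ := by
  have hker : L ∈ LinearMap.range Φ.dualMap := by
    rw [LinearMap.range_dualMap_eq_dualAnnihilator_ker, Submodule.mem_dualAnnihilator]
    intro a ha
    rw [LinearMap.mem_ker] at ha
    have h1 := hL a (by rw [ha])
    have h2 := hL (-a) (by rw [map_neg, ha, neg_zero])
    rw [map_neg] at h2
    linarith
  obtain ⟨g0, hg0⟩ := hker
  have hg0' : ∀ a, g0 (Φ a) = L a := fun a => by rw [← hg0]; rfl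
  obtain ⟨g, hg, hgp⟩ := riesz_extension (PointedCone.positive ℝ C(X, ℝ))
    ⟨LinearMap.range Φ, g0.domRestrict _⟩ (by
      rintro ⟨_, a, rfl⟩ h
      change 0 ≤ g0 (Φ a)
      rw [hg0']
      exact hL a (by simpa using h)) (by
      intro y
      refine ⟨⟨Φ (‖y‖ • 1), LinearMap.mem_range_self _ _⟩, ?_⟩
      rw [PointedCone.mem_positive, ContinuousMap.le_def]
      intro x
      have := (abs_le.1 (y.norm_coe_le_norm x)).1
      simp [hΦ]
      linarith)
  have hgL : ∀ a, g (Φ a) = L a := fun a => by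
    have := hg ⟨Φ a, LinearMap.mem_range_self _ _⟩
    rw [← hg0' a]; exact this
  let l : C_c(X, ℝ) →ₗ[ℝ] ℝ :=
    { toFun := fun f => g f.toContinuousMap
      map_add' := fun f h => by rw [← map_add]; rfl
      map_smul' := fun c f => by rw [RingHom.id_apply, ← map_smul]; rfl }
  let Λ : C_c(X, ℝ) →ₚ[ℝ] ℝ := PositiveLinearMap.mk₀ l (fun f hf => hgp _ (by
    rw [PointedCone.mem_positive, ContinuousMap.le_def]
    exact fun x => hf x))
  refine ⟨RealRMK.rieszMeasure Λ, inferInstance, fun a => ?_⟩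
  have := RealRMK.integral_rieszMeasure Λ (continuousMapEquiv (Φ a))
  rw [← hgL a]
  exact this.symm
end M6

theorem M6.charSet_closed : IsClosed (charSet A) := by
  have : charSet A = {f | (∀ a b, f (a + b) = f a + f b) ∧ (∀ (c : ℝ) a, f (c • a) = c * f a) ∧
      f 1 = 1 ∧ (∀ a b, f (a * b) = f a * f b)} := by
    ext f
    constructor
    · rintro ⟨ψ, rfl⟩
      exact ⟨map_add ψ, fun c a => by simp, map_one ψ, map_mul ψ⟩
    · rintro ⟨h1, h2, h3, h4⟩
      exact ⟨AlgHom.ofLinearMap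
        { toFun := f, map_add' := h1, map_smul' := fun c a => by simpa using h2 c a } h3 h4, rfl⟩
  rw [this]
  simp only [Set.ofPred_and, Set.ofPred_forall]
  refine IsClosed.inter ?_ (IsClosed.inter ?_ (IsClosed.inter ?_ ?_))
  · exact isClosed_iInter fun a => isClosed_iInter fun b =>
      isClosed_eq (by fun_prop) (by fun_prop)
  · exact isClosed_iInter fun a => isClosed_iInter fun b =>
      isClosed_eq (by fun_prop) (by fun_prop)
  · exact isClosed_eq (by fun_prop) (by fun_prop)
  · exact isClosed_iInter fun a => isClosed_iInter fun b =>
      isClosed_eq (by fun_prop) (by fun_prop)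

theorem M6.K_compact (T : A → ℝ) :
    IsCompact ({φ ∈ charSet A | ∀ a : A, |φ a| ≤ T a} : Set (A → ℝ)) := by
  have hc : IsCompact (Set.univ.pi fun a : A => Set.Icc (-T a) (T a)) :=
    isCompact_univ_pi fun a => isCompact_Icc
  refine (hc.inter_left M6.charSet_closed).of_isClosed_subset ?_ ?_
  · simp only [Set.ofPred_and, Set.ofPred_forall]
    exact IsClosed.inter M6.charSet_closed
      (isClosed_iInter fun a => isClosed_le (by fun_prop) (by fun_prop))
  · rintro f ⟨h1, h2⟩
    exact ⟨h1, fun a _ => abs_le.1 (h2 a)⟩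

theorem stmt6 (hX : Nonempty (A →ₐ[ℝ] ℝ)) (T : A → ℝ) (hT : ∀ a : A, 0 < T a)
    (L : A →ₗ[ℝ] ℝ) (h1 : L 1 = 1) :
    (∃ μ : Measure ({φ ∈ charSet A | ∀ a : A, |φ a| ≤ T a} : Set (A → ℝ)),
        IsFiniteMeasure μ ∧ ∀ a : A, L a = ∫ φ, (φ : A → ℝ) a ∂μ) ↔
    (∀ (a : A) (p q : ℕ),
      0 ≤ L ((algebraMap ℝ A (T a) - a) ^ p * (algebraMap ℝ A (T a) + a) ^ q)) := by
  constructor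
  · rintro ⟨μ, -, h⟩ a p q
    rw [h]
    refine integral_nonneg ?_
    rintro ⟨_, ⟨ψ, rfl⟩, hψ⟩
    have := abs_le.1 (hψ a)
    simp only [Pi.zero_apply, map_mul, map_pow, map_sub, map_add, AlgHom.commutes,
      Algebra.algebraMap_self, RingHom.id_apply]
    exact mul_nonneg (pow_nonneg (by linarith) _) (pow_nonneg (by linarith) _)
  · intro h
    have hS : ⇑L ∈ M6.S T := by
      have main : ∀ a : A, 0 ≤ L (a * a) ∧ ∀ n : ℕ, L (a ^ (2 * n)) ≤ T a ^ (2 * n) := by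
        intro a
        have hTa := hT a
        set c : ℝ := 1 / (2 * T a) with hc
        have hc0 : 0 < c := by rw [hc]; positivity
        set u : A := c • (algebraMap ℝ A (T a) + a) with hu
        set v : A := c • (algebraMap ℝ A (T a) - a) with hv
        have huv : u + v = 1 := by
          rw [hu, hv, ← smul_add, add_add_sub_cancel, ← map_add, Algebra.smul_def, ← map_mul]
          have : c * (T a + T a) = 1 := by rw [hc]; field_simp; norm_num
          rw [this, map_one]
        have hd : u - v = (T a)⁻¹ • a := by
          rw [hu, hv, ← smul_sub, add_sub_sub_cancel, ← two_smul ℝ a, smul_smul]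
          congr 1
          rw [hc]; field_simp
        have hpq : ∀ p q : ℕ, 0 ≤ L (v ^ p * u ^ q) := by
          intro p q
          rw [hu, hv, smul_pow, smul_pow, smul_mul_smul_comm, map_smul, smul_eq_mul]
          exact mul_nonneg (by positivity) (h a p q)
        constructor
        · have := M6.sqpos L u v huv hpq
          rw [hd, smul_mul_smul_comm, map_smul, smul_eq_mul] at this
          exact nonneg_of_mul_nonneg_right this (by positivity)
        · intro n
          have := (M6.powbd L u v huv hpq (2 * n) 0 0).1
          rw [hd, pow_zero, pow_zero, mul_one, mul_one, map_sub, h1, smul_pow, map_smul,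
            smul_eq_mul, inv_pow, sub_nonneg, inv_mul_le_iff₀ (by positivity), mul_one] at this
          exact this
      exact ⟨map_add L, fun c a => by simp, h1, fun b => (main b).1, fun a => (main a).2⟩
    set K : Set (A → ℝ) := {φ ∈ charSet A | ∀ a : A, |φ a| ≤ T a} with hK
    haveI : CompactSpace K := isCompact_iff_compactSpace.1 (M6.K_compact T)
    let Φ : A →ₗ[ℝ] C(K, ℝ) :=
      { toFun := fun a => ⟨fun φ => (φ : A → ℝ) a, (continuous_apply a).comp continuous_subtype_val⟩
        map_add' := fun a b => by
          ext ⟨_, ⟨ψ, rfl⟩, hψ⟩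
          simp
        map_smul' := fun c a => by
          ext ⟨_, ⟨ψ, rfl⟩, hψ⟩
          simp }
    have hΦ1 : Φ 1 = 1 := by
      ext ⟨_, ⟨ψ, rfl⟩, hψ⟩
      simp [Φ]
    have hpos : ∀ a, 0 ≤ Φ a → 0 ≤ L a := fun a ha =>
      M6.S_nonneg hT L hS a fun φ hφ => ha ⟨φ, ⟨φ, rfl⟩, hφ⟩
    have hle : (inferInstance : MeasurableSpace K) ≤ borel K := by
      have : @Measurable K (A → ℝ) (borel K) _ Subtype.val := by
        letI : MeasurableSpace K := borel K
        haveI : BorelSpace K := ⟨rfl⟩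
        refine measurable_pi_iff.2 fun a => ?_
        have : Continuous fun φ : K => (φ : A → ℝ) a :=
          (continuous_apply a).comp continuous_subtype_val
        exact this.measurable
      exact this.comap_le
    obtain ⟨μ, hμ, hμL⟩ := @M6.repr A _ _ K _ _ _ (borel K)
      (@BorelSpace.mk K _ (borel K) rfl) Φ hΦ1 L hpos
    refine ⟨μ.trim hle, isFiniteMeasure_trim hle, fun a => ?_⟩
    rw [hμL a]
    refine integral_trim hle ?_
    exact ((measurable_pi_apply a).comp measurable_subtype_coe).stronglyMeasurable
end

section
/- Let A = ℝ[x₁,…,x_s] and L : A → ℝ linear with L(1)=1. Then L is a moment functional on the closed unit ball B^s = {x ∈ ℝ^s : x₁²+⋯+x_s² ≤ 1} if and only if L((1 − x₁² − ⋯ − x_s²)^ε (1−x₁)^{m₁}(1+x₁)^{n₁} ⋯ (1−x_s)^{m_s}(1+x_s)^{n_s}) ≥ 0 for all ε ∈ {0,1} and all m₁,n₁,…,m_s,n_s ∈ ℕ₀. -/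
open MeasureTheory MvPolynomial

open Filter Topology in
lemma key_coef (s : ℕ) (P : MvPolynomial (Fin s) ℝ)
    (hP : ∀ x : Fin s → ℝ, (∀ i, x i ∈ Set.Icc (0:ℝ) 1) → 0 < eval x P) (d : ℕ) :
    ∃ n : ℕ, d ≤ n ∧ ∀ j : Fin s → ℕ, (∀ i, j i ≤ n) →
      0 ≤ ∑ a ∈ P.support, P.coeff a *
        ∏ i, ∏ k ∈ Finset.range (a i), (((j i : ℝ) - k) / ((n : ℝ) - k)) := by
  let l : Filter (ℕ × (Fin s → ℕ)) := comap Prod.fst atTop ⊓ 𝓟 {p | ∀ i, p.2 i ≤ p.1}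
  have key : ∀ᶠ p in l, 0 ≤ ∑ a ∈ P.support, P.coeff a *
        ∏ i, ∏ k ∈ Finset.range (a i), (((p.2 i : ℝ) - k) / ((p.1 : ℝ) - k)) := by
    rw [Filter.Eventually, Filter.mem_iff_ultrafilter]
    intro U hU
    have hn : Tendsto (fun p : ℕ × (Fin s → ℕ) => (p.1 : ℝ)) U atTop :=
      tendsto_natCast_atTop_atTop.comp (tendsto_comap.mono_left (hU.trans inf_le_left))
    have hle : ∀ᶠ p in (U : Filter (ℕ × (Fin s → ℕ))), ∀ i, p.2 i ≤ p.1 :=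
      (hU.trans inf_le_right) (mem_principal_self _)
    have hx : ∀ i, ∃ x ∈ Set.Icc (0:ℝ) 1,
        Tendsto (fun p : ℕ × (Fin s → ℕ) => (p.2 i : ℝ) / p.1) U (𝓝 x) := by
      intro i
      have := (isCompact_Icc (a := (0:ℝ)) (b := 1)).ultrafilter_le_nhds
        (U.map (fun p : ℕ × (Fin s → ℕ) => (p.2 i : ℝ) / p.1)) (by
          rw [le_principal_iff]
          change ∀ᶠ p in (U : Filter (ℕ × (Fin s → ℕ))), _
          filter_upwards [hle] with p hp
          have h2 : (p.2 i : ℝ) ≤ p.1 := by exact_mod_cast hp i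
          exact ⟨by positivity, div_le_one_of_le₀ h2 (by positivity)⟩)
      exact this
    choose x hx01 hx using hx
    have hfac : ∀ i (k : ℕ), Tendsto (fun p : ℕ × (Fin s → ℕ) =>
        (((p.2 i : ℝ) - k) / ((p.1 : ℝ) - k))) U (𝓝 (x i)) := by
      intro i k
      have hinv : Tendsto (fun p : ℕ × (Fin s → ℕ) => (k : ℝ) / (p.1 : ℝ)) U (𝓝 0) :=
        hn.const_div_atTop _
      have := ((hx i).sub hinv).div (tendsto_const_nhds (x := (1:ℝ)).sub hinv) (by simp)
      simp only [sub_zero, div_one] at this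
      refine this.congr' ?_
      filter_upwards [hn.eventually_gt_atTop 0] with p hp
      have : (p.1 : ℝ) ≠ 0 := hp.ne'
      simp only [Pi.div_apply]
      rw [← sub_div, one_sub_div this, div_div_div_cancel_right₀ this]
    have hlim : Tendsto (fun p : ℕ × (Fin s → ℕ) => ∑ a ∈ P.support, P.coeff a *
        ∏ i, ∏ k ∈ Finset.range (a i), (((p.2 i : ℝ) - k) / ((p.1 : ℝ) - k))) U
        (𝓝 (∑ a ∈ P.support, P.coeff a * ∏ i, ∏ k ∈ Finset.range (a i), x i)) :=
      tendsto_finsetSum _ fun a _ => (tendsto_finsetProd _ fun i _ =>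
        tendsto_finsetProd _ fun k _ => hfac i k).const_mul _
    have hpos : 0 < ∑ a ∈ P.support, P.coeff a * ∏ i, ∏ k ∈ Finset.range (a i), x i := by
      have := hP x hx01
      rw [eval_eq'] at this
      simpa using this
    exact (hlim.eventually (lt_mem_nhds hpos)).mono fun p hp => le_of_lt hp
  rw [Filter.eventually_inf_principal, Filter.eventually_comap] at key
  obtain ⟨n, hn, hdn⟩ := (key.and (eventually_ge_atTop d)).exists
  exact ⟨n, hdn, fun j hj => hn (n, j) rfl hj⟩

lemma bern_id {A : Type*} [CommRing A] [Algebra ℝ A] (u v : A) (huv : u + v = 1) (n k : ℕ)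
    (hk : k ≤ n) :
    u ^ k = ∑ j ∈ Finset.range (n + 1),
      algebraMap ℝ A ((∏ i ∈ Finset.range k, (((j : ℝ) - i) / ((n : ℝ) - i))) * (n.choose j)) *
        (u ^ j * v ^ (n - j)) := by
  induction k generalizing n with
  | zero =>
    have := add_pow u v n
    rw [huv, one_pow] at this
    rw [pow_zero, this]
    refine Finset.sum_congr rfl fun j _ => ?_
    simp; ring
  | succ k ih =>
    obtain ⟨n, rfl⟩ : ∃ n', n = n' + 1 := ⟨n - 1, by omega⟩
    rw [pow_succ, ih n (by omega), Finset.sum_mul, Finset.sum_range_succ' _ (n + 1)]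
    have h0 : ∏ i ∈ Finset.range (k + 1), ((((0 : ℕ) : ℝ) - i) / (((n + 1 : ℕ) : ℝ) - i)) = 0 :=
      Finset.prod_eq_zero (i := 0) (by simp) (by simp)
    rw [h0]
    simp only [zero_mul, map_zero, add_zero]
    refine Finset.sum_congr rfl fun j hj => ?_
    have hc : (∏ i ∈ Finset.range (k + 1), ((((j + 1 : ℕ) : ℝ) - i) / (((n + 1 : ℕ) : ℝ) - i))) *
        ((n + 1).choose (j + 1)) =
        (∏ i ∈ Finset.range k, (((j : ℝ) - i) / ((n : ℝ) - i))) * (n.choose j) := by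
      rw [Finset.prod_range_succ']
      have h1 : ((n + 1 : ℕ) : ℝ) * (n.choose j) = ((n + 1).choose (j + 1)) * ((j + 1 : ℕ) : ℝ) := by
        exact_mod_cast Nat.add_one_mul_choose_eq n j
      have h2 : ((n + 1 : ℕ) : ℝ) ≠ 0 := by positivity
      have h3 : ∀ i ∈ Finset.range k, ((((j + 1 : ℕ) : ℝ) - (i + 1 : ℕ)) /
          (((n + 1 : ℕ) : ℝ) - (i + 1 : ℕ))) = (((j : ℝ) - i) / ((n : ℝ) - i)) := by
        intro i _
        push_cast
        rw [add_sub_add_right_eq_sub, add_sub_add_right_eq_sub]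
      rw [Finset.prod_congr rfl h3, mul_assoc]
      congr 1
      rw [Nat.cast_zero, sub_zero, sub_zero, div_mul_eq_mul_div, div_eq_iff h2]
      linarith
    rw [hc, Nat.add_sub_add_right]
    ring

lemma cone_pos (s : ℕ) (M : MvPolynomial (Fin s) ℝ →ₗ[ℝ] ℝ)
    (hM : ∀ m n : Fin s → ℕ, 0 ≤ M (∏ i, ((1 - X i) ^ (m i) * (1 + X i) ^ (n i))))
    (P : MvPolynomial (Fin s) ℝ)
    (hP : ∀ x : Fin s → ℝ, (∀ i, x i ∈ Set.Icc (-1:ℝ) 1) → 0 < eval x P) : 0 ≤ M P := by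
  classical
  let Q : MvPolynomial (Fin s) ℝ := aeval (fun i => 2 * X i - 1 : Fin s → MvPolynomial (Fin s) ℝ) P
  let u : Fin s → MvPolynomial (Fin s) ℝ := fun i => C (1/2) * (1 + X i)
  let v : Fin s → MvPolynomial (Fin s) ℝ := fun i => C (1/2) * (1 - X i)
  have hC : (C (1/2) : MvPolynomial (Fin s) ℝ) * 2 = 1 := by
    rw [show (2 : MvPolynomial (Fin s) ℝ) = C 2 from (map_ofNat C 2).symm, ← C_mul]; norm_num
  have huv : ∀ i, u i + v i = 1 := fun i => by
    simp only [u, v]; linear_combination hC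
  have hPQ : aeval u Q = P := by
    have : (aeval u).comp (aeval (fun i => 2 * X i - 1 : Fin s → MvPolynomial (Fin s) ℝ)) =
        AlgHom.id ℝ (MvPolynomial (Fin s) ℝ) := by
      ext1 i
      simp only [AlgHom.comp_apply, aeval_X, map_sub, map_mul, map_one, map_ofNat, u, AlgHom.id_apply]
      linear_combination (1 + X i) * hC
    exact DFunLike.congr_fun this P
  have hQ : ∀ x : Fin s → ℝ, (∀ i, x i ∈ Set.Icc (0:ℝ) 1) → 0 < eval x Q := by
    intro x hx
    have : eval x Q = eval (fun i => 2 * x i - 1) P := by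
      have : (aeval x : MvPolynomial (Fin s) ℝ →ₐ[ℝ] ℝ).comp
          (aeval (fun i => 2 * X i - 1 : Fin s → MvPolynomial (Fin s) ℝ)) =
          aeval (fun i => 2 * x i - 1) := by
        ext1 i
        simp
      have := DFunLike.congr_fun this P
      simpa [aeval_eq_eval, Q] using this
    rw [this]
    refine hP _ fun i => ?_
    have := hx i
    constructor <;> linarith [this.1, this.2]
  obtain ⟨n, hdn, hn⟩ := key_coef s Q hQ Q.totalDegree
  have hrep : P = ∑ j ∈ Fintype.piFinset fun _ : Fin s => Finset.range (n + 1),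
      C ((∑ a ∈ Q.support, Q.coeff a *
        ∏ i, ∏ k ∈ Finset.range (a i), (((j i : ℝ) - k) / ((n : ℝ) - k))) *
        ∏ i, ((n.choose (j i) : ℝ) * ((1/2) ^ (j i) * (1/2) ^ (n - j i)))) *
      ∏ i, ((1 - X i) ^ (n - j i) * (1 + X i) ^ (j i)) := by
    conv_lhs => rw [← hPQ, aeval_def, eval₂_eq']
    have h1 : ∀ a ∈ Q.support, ∏ i, u i ^ a i =
        ∑ j ∈ Fintype.piFinset fun _ : Fin s => Finset.range (n + 1),
          ∏ i, (algebraMap ℝ (MvPolynomial (Fin s) ℝ)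
            ((∏ k ∈ Finset.range (a i), (((j i : ℝ) - k) / ((n : ℝ) - k))) * (n.choose (j i))) *
            (u i ^ j i * v i ^ (n - j i))) := by
      intro a ha
      refine Eq.trans ?_ (Finset.prod_univ_sum (fun _ : Fin s => Finset.range (n + 1))
        (fun i j => algebraMap ℝ (MvPolynomial (Fin s) ℝ)
            ((∏ k ∈ Finset.range (a i), (((j : ℝ) - k) / ((n : ℝ) - k))) * (n.choose j)) *
            (u i ^ j * v i ^ (n - j))))
      refine Finset.prod_congr rfl fun i _ => ?_
      refine bern_id _ _ (huv i) n (a i) (le_trans ?_ hdn)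
      refine le_trans ?_ (le_totalDegree ha)
      rw [Finsupp.sum_fintype _ _ (fun _ => rfl)]
      exact Finset.single_le_sum (f := fun i => a i) (fun _ _ => Nat.zero_le _) (Finset.mem_univ i)
    rw [Finset.sum_congr rfl fun a ha => by rw [h1 a ha]]
    simp only [Finset.mul_sum]
    rw [Finset.sum_comm]
    refine Finset.sum_congr rfl fun j hj => ?_
    rw [Finset.sum_mul, map_sum, Finset.sum_mul]
    refine Finset.sum_congr rfl fun a ha => ?_
    simp only [u, v, algebraMap_eq, map_mul, map_prod, map_pow, mul_pow, Finset.prod_mul_distrib]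
    ring
  rw [hrep, map_sum]
  refine Finset.sum_nonneg fun j hj => ?_
  rw [← smul_eq_C_mul, map_smul, smul_eq_mul]
  refine mul_nonneg (mul_nonneg (hn j fun i => ?_) (by positivity)) (hM _ _)
  have := Fintype.mem_piFinset.1 hj i
  rw [Finset.mem_range] at this
  omega

lemma cone_nonneg (s : ℕ) (M : MvPolynomial (Fin s) ℝ →ₗ[ℝ] ℝ)
    (hM : ∀ m n : Fin s → ℕ, 0 ≤ M (∏ i, ((1 - X i) ^ (m i) * (1 + X i) ^ (n i))))
    (P : MvPolynomial (Fin s) ℝ)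
    (hP : ∀ x : Fin s → ℝ, (∀ i, x i ∈ Set.Icc (-1:ℝ) 1) → 0 ≤ eval x P) : 0 ≤ M P := by
  have h1 : 0 ≤ M 1 := by simpa using hM 0 0
  have : ∀ ε : ℝ, 0 < ε → 0 ≤ M P + ε * M 1 := by
    intro ε hε
    have := cone_pos s M hM (P + ε • 1) (fun x hx => by
      have := hP x hx
      simp [smul_eval]; linarith)
    simpa using this
  by_contra hneg
  push Not at hneg
  have := this (-(M P) / (2 * (M 1 + 1))) (by apply div_pos <;> linarith)
  have h3 : -(M P) / (2 * (M 1 + 1)) * M 1 ≤ -(M P) / 2 := by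
    rw [div_mul_eq_mul_div, div_le_div_iff₀ (by linarith) (by norm_num)]
    nlinarith
  linarith

open Filter Topology in
lemma ball_nonneg (s : ℕ) (L : MvPolynomial (Fin s) ℝ →ₗ[ℝ] ℝ) (h1 : L 1 = 1)
    (hL : ∀ ε : ℕ, ε ≤ 1 → ∀ m n : Fin s → ℕ,
      0 ≤ L ((1 - ∑ i, X i ^ 2) ^ ε * ∏ i, ((1 - X i) ^ (m i) * (1 + X i) ^ (n i))))
    (P : MvPolynomial (Fin s) ℝ)
    (hP : ∀ x : Fin s → ℝ, ∑ i, x i ^ 2 ≤ 1 → 0 ≤ eval x P) : 0 ≤ L P := by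
  refine le_of_forall_pos_le_add fun ε hε => ?_
  have hN : ∃ N : ℕ, ∀ x : Fin s → ℝ, (∀ i, x i ∈ Set.Icc (-1:ℝ) 1) →
      0 < eval x P + ε - (1 - ∑ i, x i ^ 2) * (∑ i, x i ^ 2) ^ N := by
    by_contra hcon
    push Not at hcon
    choose x hx hxN using hcon
    have hcomp : IsCompact (Set.univ.pi fun _ : Fin s => Set.Icc (-1:ℝ) 1) :=
      isCompact_univ_pi fun _ => isCompact_Icc
    obtain ⟨y, -, φ, hφ, hy⟩ := hcomp.tendsto_subseq (x := x) (fun n i _ => hx n i)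
    have hPy : Tendsto (fun n => eval (x (φ n)) P) atTop (𝓝 (eval y P)) :=
      ((MvPolynomial.continuous_eval P).tendsto y).comp hy
    have hqc : Continuous (fun z : Fin s → ℝ => ∑ i, z i ^ 2) := by fun_prop
    have hqy : Tendsto (fun n => ∑ i, x (φ n) i ^ 2) atTop (𝓝 (∑ i, y i ^ 2)) :=
      (hqc.tendsto y).comp hy
    have hq0 : ∀ z : Fin s → ℝ, 0 ≤ ∑ i, z i ^ 2 := fun z =>
      Finset.sum_nonneg fun i _ => sq_nonneg _
    have hφn : Tendsto (fun n => (φ n : ℝ)) atTop atTop :=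
      tendsto_natCast_atTop_atTop.comp hφ.tendsto_atTop
    rcases le_or_gt (∑ i, y i ^ 2) 1 with hle | hgt
    · have hb : ∀ (q : ℝ), 0 ≤ q → ∀ N : ℕ, (1 - q) * q ^ N ≤ 1 / ((N : ℝ) + 1) := by
        intro q hq N
        rcases le_or_gt q 1 with hq1 | hq1
        · rw [le_div_iff₀ (by positivity)]
          have h2 : ((N : ℝ) + 1) * q ^ N ≤ ∑ k ∈ Finset.range (N + 1), q ^ k := by
            have := Finset.card_nsmul_le_sum (Finset.range (N + 1)) (fun k => q ^ k) (q ^ N)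
              (fun k hk => pow_le_pow_of_le_one hq hq1 (by
                rw [Finset.mem_range] at hk; omega))
            simpa using this
          have h3 := mul_neg_geom_sum q (N + 1)
          have h4 : 0 ≤ q ^ (N + 1) := by positivity
          have h5 := mul_le_mul_of_nonneg_left h2 (sub_nonneg.2 hq1)
          nlinarith
        · have : 0 ≤ q ^ N := by positivity
          have h2 : (0:ℝ) ≤ 1 / ((N : ℝ) + 1) := by positivity
          nlinarith
      have hlim : Tendsto (fun n => 1 / ((φ n : ℝ) + 1)) atTop (𝓝 0) :=
        (tendsto_one_div_add_atTop_nhds_zero_nat (𝕜 := ℝ)).comp hφ.tendsto_atTop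
      have := le_of_tendsto_of_tendsto' (hPy.add_const ε) hlim fun n => by
        have a := hxN (φ n)
        have b := hb _ (hq0 (x (φ n))) (φ n)
        linarith
      have := hP y hle
      linarith
    · obtain ⟨δ, hδ, hδy⟩ : ∃ δ > 0, 1 + δ < ∑ i, y i ^ 2 :=
        ⟨(∑ i, y i ^ 2 - 1) / 2, by linarith, by linarith⟩
      have e1 := hqy.eventually (lt_mem_nhds hδy)
      have e2 := hPy.eventually (lt_mem_nhds (sub_one_lt (eval y P)))
      have e3 := (hφn.atTop_mul_const (mul_pos hδ hδ)).eventually_gt_atTop (1 - eval y P)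
      obtain ⟨n, h1, h2, h3⟩ := (e1.and (e2.and e3)).exists
      have a := hxN (φ n)
      have b := one_add_mul_le_pow (a := δ) (by linarith) (φ n)
      have c : (1 + δ) ^ φ n ≤ (∑ i, x (φ n) i ^ 2) ^ φ n :=
        pow_le_pow_left₀ (by linarith) h1.le _
      have d : δ * (1 + φ n * δ) ≤
          (∑ i, x (φ n) i ^ 2 - 1) * (∑ i, x (φ n) i ^ 2) ^ φ n :=
        mul_le_mul (by linarith) (b.trans c) (by positivity) (by linarith)
      nlinarith
  obtain ⟨N, hN⟩ := hN
  have hA := cone_nonneg s L (fun m n => by simpa using hL 0 (by norm_num) m n)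
    (P + ε • 1 - (1 - ∑ i, X i ^ 2) * (∑ i, X i ^ 2) ^ N) (fun x hx => by
      have := hN x hx
      simp [smul_eval]
      linarith)
  have hB := cone_nonneg s (L.comp (LinearMap.mulLeft ℝ (1 - ∑ i, X i ^ 2)))
    (fun m n => by simpa using hL 1 le_rfl m n) ((∑ i, X i ^ 2) ^ N) (fun x hx => by
      simp only [map_pow, map_sum, eval_X]
      positivity)
  simp [h1] at hA hB
  linarith

theorem stmt7 (s : ℕ) (L : MvPolynomial (Fin s) ℝ →ₗ[ℝ] ℝ) (h1 : L 1 = 1) :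
    (∃ μ : Measure ({x : Fin s → ℝ | ∑ i, x i ^ 2 ≤ 1} : Set (Fin s → ℝ)),
        IsFiniteMeasure μ ∧
        ∀ P : MvPolynomial (Fin s) ℝ, L P = ∫ x, MvPolynomial.eval (x : Fin s → ℝ) P ∂μ) ↔
    (∀ ε : ℕ, ε ≤ 1 → ∀ m n : Fin s → ℕ,
      0 ≤ L ((1 - ∑ i, X i ^ 2) ^ ε * ∏ i, ((1 - X i) ^ (m i) * (1 + X i) ^ (n i)))) := by
  have hcube : ∀ x : Fin s → ℝ, ∑ i, x i ^ 2 ≤ 1 → ∀ i, x i ∈ Set.Icc (-1:ℝ) 1 := by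
    intro x hx i
    have : x i ^ 2 ≤ 1 := le_trans (Finset.single_le_sum (f := fun i => x i ^ 2)
      (fun _ _ => sq_nonneg _) (Finset.mem_univ i)) hx
    exact abs_le.1 ((sq_le_one_iff_abs_le_one _).1 this)
  constructor
  · rintro ⟨μ, -, hμ⟩ ε - m n
    rw [hμ]
    refine integral_nonneg fun x => ?_
    have hx : ∑ i, (x : Fin s → ℝ) i ^ 2 ≤ 1 := x.2
    simp only [map_mul, map_pow, map_sub, map_sum, map_prod, map_add, map_one, eval_X, Pi.zero_apply]
    refine mul_nonneg (pow_nonneg (by linarith) _) (Finset.prod_nonneg fun i _ => ?_)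
    have := hcube _ hx i
    exact mul_nonneg (pow_nonneg (by linarith [this.2]) _) (pow_nonneg (by linarith [this.1]) _)
  · intro hL
    have hpos := ball_nonneg s L h1 hL
    let K : Set (Fin s → ℝ) := {x : Fin s → ℝ | ∑ i, x i ^ 2 ≤ 1}
    have hK : IsCompact K := by
      refine IsCompact.of_isClosed_subset
        (isCompact_univ_pi fun _ : Fin s => isCompact_Icc (a := (-1:ℝ)) (b := 1))
        (isClosed_le (by fun_prop) continuous_const) fun x hx i _ => hcube x hx i
    have : CompactSpace K := isCompact_iff_compactSpace.1 hK
    let T : MvPolynomial (Fin s) ℝ →ₗ[ℝ] C(K, ℝ) :=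
      { toFun := fun P => ⟨fun x => eval (x : Fin s → ℝ) P,
          (MvPolynomial.continuous_eval P).comp continuous_subtype_val⟩
        map_add' := fun P Q => by ext x; simp
        map_smul' := fun c P => by ext x; simp [smul_eval] }
    have hT : ∀ P (x : K), T P x = eval (x : Fin s → ℝ) P := fun P x => rfl
    have hTpos : ∀ P, 0 ≤ T P → 0 ≤ L P := fun P h => hpos P fun x hx => h ⟨x, hx⟩
    have hTeq : ∀ P Q, T P = T Q → L P = L Q := by
      intro P Q h
      have a := hTpos (P - Q) (by rw [map_sub, h, sub_self])
      have b := hTpos (Q - P) (by rw [map_sub, h, sub_self])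
      rw [map_sub] at a b
      linarith
    obtain ⟨S, hS⟩ := T.rangeRestrict.exists_rightInverse_of_surjective T.range_rangeRestrict
    have hS' : ∀ y : LinearMap.range T, T (S y) = y := fun y =>
      congrArg Subtype.val (DFunLike.congr_fun hS y)
    obtain ⟨g, hg, hgpos⟩ := riesz_extension (PointedCone.positive ℝ C(K, ℝ))
      ⟨LinearMap.range T, L.comp S⟩
      (fun x hx => hTpos _ (by rw [hS']; exact hx))
      (fun y => ⟨⟨T (C ‖y‖), ⟨_, rfl⟩⟩, by
        rw [PointedCone.mem_positive]
        intro x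
        have := neg_le_of_abs_le (y.norm_coe_le_norm x)
        simp [hT]
        linarith⟩)
    have hgT : ∀ P, g (T P) = L P := fun P => by
      have := hg ⟨T P, ⟨P, rfl⟩⟩
      exact this.trans (hTeq _ _ (hS' _))
    let Λ₀ : CompactlySupportedContinuousMap K ℝ →ₗ[ℝ] ℝ :=
      { toFun := fun f => g (f : C(K, ℝ))
        map_add' := fun a b => by rw [← map_add]; rfl
        map_smul' := fun c a => by rw [RingHom.id_apply, ← map_smul]; rfl }
    let Λ := PositiveLinearMap.mk₀ Λ₀ (fun f hf => hgpos _ (fun x => CompactlySupportedContinuousMap.le_def.1 hf x))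
    refine ⟨RealRMK.rieszMeasure Λ, ?_, fun P => ?_⟩
    · exact inferInstanceAs (IsFiniteMeasure (RealRMK.rieszMeasure Λ))
    · have := RealRMK.integral_rieszMeasure Λ
        (CompactlySupportedContinuousMap.continuousMapEquiv (T P))
      rw [← hgT]
      exact this.symm
end

section
/- If p ∈ ℝ[x₁,…,x_s] satisfies p(x) > 0 for all x in the closed unit ball B^s, then p is a nonnegative linear combination of terms (1 − x₁² − ⋯ − x_s²)^ε (1−x₁)^{m₁}(1+x₁)^{n₁} ⋯ (1−x_s)^{m_s}(1+x_s)^{n_s} with ε ∈ {0,1} and m₁,n₁,…,m_s,n_s ∈ ℕ₀. -/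
open MvPolynomial

noncomputable def rr (n k j : ℕ) : ℝ := (k.descFactorial j : ℝ) / (n.descFactorial j : ℝ)

lemma rr_succ (n k j : ℕ) : rr n k (j+1) = rr n k j * (((k - j : ℕ) : ℝ) / ((n - j : ℕ) : ℝ)) := by
  unfold rr
  rw [Nat.descFactorial_succ, Nat.descFactorial_succ]
  push_cast
  rw [mul_comm ((k - j : ℕ) : ℝ), mul_comm ((n - j : ℕ) : ℝ), mul_div_mul_comm]

lemma rr_nonneg (n k j : ℕ) : 0 ≤ rr n k j := by unfold rr; positivity

lemma rr_le_one (n k j : ℕ) (h : k ≤ n) : rr n k j ≤ 1 := by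
  unfold rr
  apply div_le_one_of_le₀ _ (by positivity)
  exact_mod_cast Nat.descFactorial_le j h

lemma step_bound (n k i D : ℕ) (hn : 0 < n) (hk : k ≤ n) (hi : i < D) (hD : 2 * D ≤ n) :
    |(((k - i : ℕ) : ℝ) / ((n - i : ℕ) : ℝ)) - (k:ℝ)/n| ≤ 2 * D / n := by
  have hin : i < n := by omega
  have hn' : (0:ℝ) < n := by exact_mod_cast hn
  have hD' : (2:ℝ) * D ≤ n := by exact_mod_cast hD
  have hi' : (i:ℝ) < D := by exact_mod_cast hi
  have hk' : (k:ℝ) ≤ n := by exact_mod_cast hk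
  have hi0 : (0:ℝ) ≤ i := by positivity
  have hk0 : (0:ℝ) ≤ k := by positivity
  rcases le_total i k with h | h
  · rw [Nat.cast_sub h, Nat.cast_sub hin.le]
    have h1 : (0:ℝ) < n - i := by linarith
    have h2 : ((k:ℝ) - i) / (n - i) - k / n = - (i * (n - k) / ((n - i) * n)) := by
      field_simp; ring
    rw [h2, abs_neg, abs_of_nonneg (div_nonneg (mul_nonneg hi0 (by linarith)) (by positivity)),
      div_le_div_iff₀ (by positivity) hn']
    have h3 : (i:ℝ) * (n - k) ≤ D * n := by
      apply mul_le_mul hi'.le <;> linarith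
    have h4 : (D:ℝ) * n ≤ 2 * D * (n - i) := by nlinarith
    nlinarith
  · rw [Nat.sub_eq_zero_of_le h]
    have : (k:ℝ) ≤ i := by exact_mod_cast h
    rw [Nat.cast_zero, zero_div, zero_sub, abs_neg, abs_of_nonneg (by positivity)]
    apply div_le_div_of_nonneg_right _ hn'.le
    linarith

lemma rr_bound (n k j D : ℕ) (hn : 0 < n) (hk : k ≤ n) (hj : j ≤ D) (hD : 2 * D ≤ n) :
    |rr n k j - ((k:ℝ)/n)^j| ≤ j * (2 * D / n) := by
  induction j with
  | zero => simp [rr]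
  | succ j ih =>
    have ih := ih (by omega)
    have hs := step_bound n k j D hn hk (by omega) hD
    have h0 : (0:ℝ) ≤ (k:ℝ)/n := by positivity
    have h1 : (k:ℝ)/n ≤ 1 := div_le_one_of_le₀ (by exact_mod_cast hk) (by positivity)
    rw [rr_succ, pow_succ]
    set t : ℝ := ((k - j : ℕ) : ℝ) / ((n - j : ℕ) : ℝ)
    have e : rr n k j * t - ((k:ℝ)/n)^j * (k/n) =
      rr n k j * (t - k/n) + (rr n k j - ((k:ℝ)/n)^j) * (k/n) := by ring
    rw [e]
    refine (abs_add_le _ _).trans ?_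
    rw [abs_mul, abs_mul, abs_of_nonneg (rr_nonneg n k j), abs_of_nonneg h0]
    have a1 := mul_le_mul (rr_le_one n k j hk) hs (abs_nonneg _) zero_le_one
    have a2 := mul_le_mul ih h1 h0 ((abs_nonneg _).trans ih)
    push_cast
    linarith

lemma prod_diff {ι : Type*} (t : Finset ι) (a b : ι → ℝ) (ha0 : ∀ i, 0 ≤ a i) (ha : ∀ i, a i ≤ 1)
    (hb0 : ∀ i, 0 ≤ b i) (hb : ∀ i, b i ≤ 1) :
    |∏ i ∈ t, a i - ∏ i ∈ t, b i| ≤ ∑ i ∈ t, |a i - b i| := by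
  classical
  induction t using Finset.induction_on with
  | empty => simp
  | insert i t hi ih =>
    rw [Finset.prod_insert hi, Finset.prod_insert hi, Finset.sum_insert hi]
    have e : a i * ∏ i ∈ t, a i - b i * ∏ i ∈ t, b i =
      (a i - b i) * ∏ i ∈ t, a i + b i * (∏ i ∈ t, a i - ∏ i ∈ t, b i) := by ring
    rw [e]
    refine (abs_add_le _ _).trans ?_
    have p0 : 0 ≤ ∏ i ∈ t, a i := Finset.prod_nonneg fun i _ => ha0 i
    have p1 : ∏ i ∈ t, a i ≤ 1 := Finset.prod_le_one (fun i _ => ha0 i) fun i _ => ha i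
    rw [abs_mul, abs_mul, abs_of_nonneg p0, abs_of_nonneg (hb0 i)]
    have := mul_le_mul_of_nonneg_left p1 (abs_nonneg (a i - b i))
    have := mul_le_mul (hb i) ih (abs_nonneg _) zero_le_one
    linarith

/-- Power as a combination of Bernstein basis elements. -/
lemma pow_bern {A : Type*} [CommRing A] [Algebra ℝ A] (a b : A) (hab : a + b = 1) (n j : ℕ)
    (hj : j ≤ n) :
    a ^ j = ∑ k ∈ Finset.range (n+1), rr n k j • ((n.choose k : ℝ) • (a ^ k * b ^ (n - k))) := by
  have h1 : a ^ j = a ^ j * (a + b) ^ (n - j) := by rw [hab]; simp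
  rw [h1, add_pow, Finset.mul_sum]
  have e : n + 1 = j + (n - j + 1) := by omega
  rw [e, Finset.sum_range_add _ j (n - j + 1)]
  have hz : ∑ k ∈ Finset.range j, rr n k j • ((n.choose k : ℝ) • (a ^ k * b ^ (n - k))) = 0 := by
    refine Finset.sum_eq_zero fun k hk => ?_
    have : k < j := by simpa using hk
    simp [rr, Nat.descFactorial_of_lt this]
  rw [hz, zero_add]
  · refine Finset.sum_congr rfl fun m hm => ?_
    have hm' : m ≤ n - j := by simpa [Nat.lt_succ_iff] using hm
    have hc : rr n (j+m) j * (n.choose (j+m) : ℝ) = ((n-j).choose m : ℝ) := by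
      unfold rr
      rw [div_mul_eq_mul_div, div_eq_iff (by
        have := Nat.descFactorial_pos.mpr hj
        positivity)]
      have := Nat.choose_mul (n := n) (k := j+m) (s := j) (by omega)
      rw [Nat.add_sub_cancel_left] at this
      rw [Nat.descFactorial_eq_factorial_mul_choose, Nat.descFactorial_eq_factorial_mul_choose]
      have h' : (n.choose (j+m) : ℝ) * ((j+m).choose j) = n.choose j * (n-j).choose m := by
        exact_mod_cast this
      push_cast
      linear_combination (j.factorial : ℝ) * h'
    rw [smul_smul, hc, pow_add, Nat.sub_sub, Algebra.smul_def, map_natCast]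
    ring

def GG (s : ℕ) : Submonoid (MvPolynomial (Fin s) ℝ) where
  carrier := {f | ∃ (c : ℝ) (m n : Fin s → ℕ), 0 ≤ c ∧
    f = c • ∏ j, ((1 - X j) ^ (m j) * (1 + X j) ^ (n j))}
  one_mem' := ⟨1, 0, 0, zero_le_one, by simp⟩
  mul_mem' := by
    rintro _ _ ⟨c, m, n, hc, rfl⟩ ⟨c', m', n', hc', rfl⟩
    refine ⟨c * c', m + m', n + n', mul_nonneg hc hc', ?_⟩
    rw [smul_mul_smul_comm, ← Finset.prod_mul_distrib]
    congr 1
    refine Finset.prod_congr rfl fun j _ => ?_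
    simp only [Pi.add_apply, pow_add]; ring

noncomputable def SS (s : ℕ) : Subsemiring (MvPolynomial (Fin s) ℝ) := (GG s).subsemiringClosure

lemma SS_of_GG {s : ℕ} {f : MvPolynomial (Fin s) ℝ} (h : f ∈ GG s) : f ∈ SS s :=
  AddSubmonoid.subset_closure h

lemma SS_const {s : ℕ} {c : ℝ} (hc : 0 ≤ c) : (C c : MvPolynomial (Fin s) ℝ) ∈ SS s :=
  SS_of_GG ⟨c, 0, 0, hc, by simp [smul_eq_C_mul]⟩

lemma SS_smul {s : ℕ} {c : ℝ} (hc : 0 ≤ c) {f : MvPolynomial (Fin s) ℝ} (hf : f ∈ SS s) :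
    c • f ∈ SS s := by
  rw [smul_eq_C_mul]; exact mul_mem (SS_const hc) hf

lemma SS_sub {s : ℕ} (i : Fin s) : (1 - X i : MvPolynomial (Fin s) ℝ) ∈ SS s :=
  SS_of_GG ⟨1, Pi.single i 1, 0, zero_le_one, by
    rw [Finset.prod_eq_single i] <;> simp +contextual⟩

lemma SS_add {s : ℕ} (i : Fin s) : (1 + X i : MvPolynomial (Fin s) ℝ) ∈ SS s :=
  SS_of_GG ⟨1, 0, Pi.single i 1, zero_le_one, by
    rw [Finset.prod_eq_single i] <;> simp +contextual⟩

lemma handelman {s : ℕ} (f : MvPolynomial (Fin s) ℝ)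
    (hf : ∀ x ∈ Set.Icc (-1 : Fin s → ℝ) 1, 0 < eval x f) : f ∈ SS s := by
  classical
  obtain ⟨x0, hx0, hmin⟩ := (isCompact_Icc (a := (-1 : Fin s → ℝ)) (b := 1)).exists_isMinOn
    (Set.nonempty_Icc.mpr (by intro i; simp)) (f := fun x => eval x f)
    (MvPolynomial.continuous_eval f).continuousOn
  set δ := eval x0 f
  have hδ : 0 < δ := hf x0 hx0
  set g : MvPolynomial (Fin s) ℝ := bind₁ (fun i => C 2 * X i - 1) f with hg
  have hge : ∀ y : Fin s → ℝ, eval y g = eval (fun i => 2 * y i - 1) f := by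
    intro y
    have h : (fun i => aeval y (C 2 * X i - 1 : MvPolynomial (Fin s) ℝ)) =
        fun i => 2 * y i - 1 := by
      funext i; simp
    rw [hg, ← coe_aeval_eq_eval, RingHom.coe_coe, aeval_bind₁, h, ← coe_aeval_eq_eval,
      RingHom.coe_coe]
  set a : Fin s → MvPolynomial (Fin s) ℝ := fun i => C (1/2) * (1 + X i)
  set b : Fin s → MvPolynomial (Fin s) ℝ := fun i => C (1/2) * (1 - X i)
  have hC : (C (1/2) * 2 : MvPolynomial (Fin s) ℝ) = 1 := by
    rw [show (2 : MvPolynomial (Fin s) ℝ) = C 2 from (map_ofNat C 2).symm, ← C_mul]; norm_num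
  have hab : ∀ i, a i + b i = 1 := by
    intro i; simp only [a, b]; linear_combination hC
  have haS : ∀ i, a i ∈ SS s := fun i => mul_mem (SS_const (by norm_num)) (SS_add i)
  have hbS : ∀ i, b i ∈ SS s := fun i => mul_mem (SS_const (by norm_num)) (SS_sub i)
  have hfg : f = aeval a g := by
    rw [hg, aeval_bind₁]
    conv_lhs => rw [← aeval_X_left_apply f]
    congr 2
    funext i
    simp only [map_sub, map_mul, aeval_X, map_one, algHom_C, a]
    rw [show (algebraMap ℝ (MvPolynomial (Fin s) ℝ)) 2 = 2 from map_ofNat _ 2]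
    linear_combination (-(1 + X i)) * hC
  set D := g.totalDegree
  set A : ℝ := ∑ d ∈ g.support, |coeff d g| * (s * (D * (2 * D)))
  obtain ⟨n0, hn0⟩ := exists_nat_gt (A / δ)
  set n := n0 + 2 * D + 1
  have hn : 0 < n := by omega
  have hn' : (0:ℝ) < n := by exact_mod_cast hn
  have hAn : A / n ≤ δ := by
    rw [div_le_iff₀ hn', mul_comm, ← div_le_iff₀ hδ]
    refine hn0.le.trans ?_
    exact_mod_cast (by omega : n0 ≤ n)
  have hd : ∀ d ∈ g.support, ∀ i, d i ≤ D := by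
    intro d hd i
    exact (Finsupp.le_degree i d).trans (le_totalDegree hd)
  set B : (Fin s → ℕ) → MvPolynomial (Fin s) ℝ := fun k =>
    ∏ i, ((n.choose (k i) : ℝ) • (a i ^ (k i) * b i ^ (n - k i)))
  have hB : ∀ k, B k ∈ SS s := fun k => prod_mem fun i _ =>
    SS_smul (by positivity) (mul_mem (pow_mem (haS i) _) (pow_mem (hbS i) _))
  have key : f = ∑ k ∈ Fintype.piFinset (fun _ : Fin s => Finset.range (n+1)),
      (∑ d ∈ g.support, coeff d g * ∏ i, rr n (k i) (d i)) • B k := by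
    rw [hfg, aeval_def, eval₂_eq']
    simp only [Finset.sum_smul]
    rw [Finset.sum_comm]
    refine Finset.sum_congr rfl fun d hdd => ?_
    rw [Finset.prod_congr rfl (fun i _ => pow_bern (a i) (b i) (hab i) n (d i)
      ((hd d hdd i).trans (by omega))), Finset.prod_univ_sum, Finset.mul_sum]
    refine Finset.sum_congr rfl fun k _ => ?_
    simp only [B]
    rw [Finset.prod_smul, mul_smul, ← Algebra.smul_def]
  rw [key]
  refine sum_mem fun k hk => SS_smul ?_ (hB k)
  have hk' : ∀ i, k i ≤ n := fun i => by
    have := Fintype.mem_piFinset.mp hk i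
    simpa [Nat.lt_succ_iff] using this
  set y : Fin s → ℝ := fun i => (k i : ℝ) / n
  have hy0 : ∀ i, 0 ≤ y i := fun i => by positivity
  have hy1 : ∀ i, y i ≤ 1 := fun i =>
    div_le_one_of_le₀ (by exact_mod_cast hk' i) (by positivity)
  have hgy : δ ≤ eval y g := by
    rw [hge]
    refine hmin (a := fun i => 2 * y i - 1) ⟨fun i => ?_, fun i => ?_⟩
    · have := hy0 i
      simp only [Pi.neg_apply, Pi.one_apply]; linarith
    · have := hy1 i
      simp only [Pi.one_apply]; linarith
  have hdiff : |∑ d ∈ g.support, coeff d g * ∏ i, rr n (k i) (d i) - eval y g| ≤ A / n := by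
    rw [eval_eq', ← Finset.sum_sub_distrib]
    refine (Finset.abs_sum_le_sum_abs _ _).trans ?_
    rw [Finset.sum_div]
    refine Finset.sum_le_sum fun d hdd => ?_
    rw [← mul_sub, abs_mul, mul_div_assoc]
    refine mul_le_mul_of_nonneg_left ?_ (abs_nonneg _)
    refine (prod_diff _ _ _ (fun i => rr_nonneg _ _ _) (fun i => rr_le_one _ _ _ (hk' i))
      (fun i => pow_nonneg (hy0 i) _) (fun i => pow_le_one₀ (hy0 i) (hy1 i))).trans ?_
    have : ∀ i ∈ Finset.univ, |rr n (k i) (d i) - y i ^ d i| ≤ (D:ℝ) * (2 * D / n) := by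
      intro i _
      refine (rr_bound n (k i) (d i) D hn (hk' i) (hd d hdd i) (by omega)).trans ?_
      refine mul_le_mul_of_nonneg_right ?_ (by positivity)
      exact_mod_cast hd d hdd i
    refine (Finset.sum_le_sum this).trans (le_of_eq ?_)
    simp
    ring
  have := (abs_le.mp hdiff).1
  linarith

/-- The representable polynomials. -/
def RR (s : ℕ) (p : MvPolynomial (Fin s) ℝ) : Prop :=
    ∃ (k : ℕ) (coef : Fin k → ℝ) (ε : Fin k → ℕ) (m n : Fin k → Fin s → ℕ),
      (∀ i, 0 ≤ coef i) ∧ (∀ i, ε i ≤ 1) ∧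
      p = ∑ i, coef i •
        ((1 - ∑ j, X j ^ 2) ^ (ε i) * ∏ j, ((1 - X j) ^ (m i j) * (1 + X j) ^ (n i j)))

lemma RR_zero (s : ℕ) : RR s 0 :=
  ⟨0, Fin.elim0, Fin.elim0, Fin.elim0, Fin.elim0, fun i => i.elim0, fun i => i.elim0, by simp⟩

lemma RR_add {s : ℕ} {f g : MvPolynomial (Fin s) ℝ} (hf : RR s f) (hg : RR s g) :
    RR s (f + g) := by
  obtain ⟨k, c, e, m, n, h1, h2, rfl⟩ := hf
  obtain ⟨k', c', e', m', n', h1', h2', rfl⟩ := hg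
  refine ⟨k + k', Fin.append c c', Fin.append e e', Fin.append m m', Fin.append n n', ?_, ?_, ?_⟩
  · intro i; refine Fin.addCases (fun i => ?_) (fun i => ?_) i <;> simp [h1, h1']
  · intro i; refine Fin.addCases (fun i => ?_) (fun i => ?_) i <;> simp [h2, h2']
  · simp [Fin.sum_univ_add]

lemma RR_SS {s : ℕ} {f : MvPolynomial (Fin s) ℝ} (hf : f ∈ SS s) (e : ℕ) (he : e ≤ 1) :
    RR s ((1 - ∑ j, X j ^ 2) ^ e * f) := by
  have hf' : f ∈ AddSubmonoid.closure (GG s : Set (MvPolynomial (Fin s) ℝ)) := hf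
  induction hf' using AddSubmonoid.closure_induction with
  | mem x hx =>
    obtain ⟨c, m, n, hc, rfl⟩ := hx
    exact ⟨1, fun _ => c, fun _ => e, fun _ => m, fun _ => n, fun _ => hc, fun _ => he, by simp⟩
  | zero => simpa using RR_zero s
  | add x y hx hy h1 h2 => rw [mul_add]; exact RR_add (h1 hx) (h2 hy)

theorem stmt9 (s : ℕ) (p : MvPolynomial (Fin s) ℝ)
    (hp : ∀ x : Fin s → ℝ, ∑ i, x i ^ 2 ≤ 1 → 0 < MvPolynomial.eval x p) :
    ∃ (k : ℕ) (coef : Fin k → ℝ) (ε : Fin k → ℕ) (m n : Fin k → Fin s → ℕ),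
      (∀ i, 0 ≤ coef i) ∧ (∀ i, ε i ≤ 1) ∧
      p = ∑ i, coef i •
        ((1 - ∑ j, X j ^ 2) ^ (ε i) * ∏ j, ((1 - X j) ^ (m i j) * (1 + X j) ^ (n i j))) := by
  change RR s p
  have hcube : IsCompact (Set.Icc (-1 : Fin s → ℝ) 1) := isCompact_Icc
  have hcp := MvPolynomial.continuous_eval p
  have hcs : Continuous fun x : Fin s → ℝ => ∑ i, x i ^ 2 := by fun_prop
  -- lower bound on the ball
  obtain ⟨η, hη, hηp⟩ : ∃ η : ℝ, 0 < η ∧ ∀ x ∈ Set.Icc (-1 : Fin s → ℝ) 1, ∑ i, x i ^ 2 ≤ 1 →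
      η < eval x p := by
    have hK : IsCompact (Set.Icc (-1 : Fin s → ℝ) 1 ∩ {x | ∑ i, x i ^ 2 ≤ 1}) :=
      hcube.inter_right (isClosed_le hcs continuous_const)
    obtain ⟨x0, hx0, hmin⟩ := hK.exists_isMinOn
      ⟨0, ⟨by intro i; simp, by intro i; simp⟩, by simp⟩ hcp.continuousOn
    refine ⟨eval x0 p / 2, half_pos (hp x0 hx0.2), fun x hx h => ?_⟩
    have h1 : eval x0 p ≤ eval x p := hmin ⟨hx, h⟩
    have := hp x0 hx0.2
    linarith
  obtain ⟨M, hM⟩ : ∃ M : ℝ, ∀ x ∈ Set.Icc (-1 : Fin s → ℝ) 1, -M < eval x p := by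
    obtain ⟨x0, hx0, hmin⟩ := hcube.exists_isMinOn ⟨0, ⟨by intro i; simp, by intro i; simp⟩⟩
      hcp.continuousOn
    refine ⟨-eval x0 p + 1, fun x hx => ?_⟩
    have h1 : eval x0 p ≤ eval x p := hmin hx
    linarith
  obtain ⟨δ, hδ, hδp⟩ : ∃ δ : ℝ, 0 < δ ∧ ∀ x ∈ Set.Icc (-1 : Fin s → ℝ) 1, eval x p ≤ 0 →
      1 + δ ≤ ∑ i, x i ^ 2 := by
    have hK : IsCompact (Set.Icc (-1 : Fin s → ℝ) 1 ∩ {x | eval x p ≤ 0}) :=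
      hcube.inter_right (isClosed_le hcp continuous_const)
    rcases Set.eq_empty_or_nonempty (Set.Icc (-1 : Fin s → ℝ) 1 ∩ {x | eval x p ≤ 0}) with h | h
    · refine ⟨1, one_pos, fun x hx hx' => ?_⟩
      have : x ∈ (Set.Icc (-1 : Fin s → ℝ) 1 ∩ {x | eval x p ≤ 0}) := ⟨hx, hx'⟩
      rw [h] at this; exact this.elim
    · obtain ⟨x0, hx0, hmin⟩ := hK.exists_isMinOn h hcs.continuousOn
      refine ⟨∑ i, x0 i ^ 2 - 1, ?_, fun x hx hx' => ?_⟩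
      · by_contra hcon
        have := hp x0 (by linarith)
        exact absurd hx0.2 (not_le.mpr this)
      · have h1 : ∑ i, x0 i ^ 2 ≤ ∑ i, x i ^ 2 := hmin ⟨hx, hx'⟩
        linarith
  have hs : (0:ℝ) < 1 + s := by positivity
  obtain ⟨N, hN⟩ := pow_unbounded_of_one_lt (M / (δ * η))
    (show 1 < (1 + s + δ) / (1 + s : ℝ) by rw [lt_div_iff₀ hs]; linarith)
  set u : MvPolynomial (Fin s) ℝ := C (1 / (1 + s : ℝ)) * ∑ i, (1 + X i ^ 2)
  have huS : u ∈ SS s := by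
    refine mul_mem (SS_const (by positivity)) (sum_mem fun i _ => ?_)
    have hC : (C (1/2) * 2 : MvPolynomial (Fin s) ℝ) = 1 := by
      rw [show (2 : MvPolynomial (Fin s) ℝ) = C 2 from (map_ofNat C 2).symm, ← C_mul]; norm_num
    have : (1 + X i ^ 2 : MvPolynomial (Fin s) ℝ) =
        C (1/2) * ((1 + X i) ^ 2 + (1 - X i) ^ 2) := by
      linear_combination (-(1 + X i ^ 2)) * hC
    rw [this]
    exact mul_mem (SS_const (by norm_num)) (add_mem (pow_mem (SS_add i) _) (pow_mem (SS_sub i) _))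
  have hue : ∀ x : Fin s → ℝ, eval x u = (s + ∑ i, x i ^ 2) / (1 + s) := by
    intro x
    simp [u, Finset.sum_add_distrib]
    field_simp
  set q := C η * u ^ N
  have hqS : q ∈ SS s := mul_mem (SS_const hη.le) (pow_mem huS _)
  have hpos : p - (1 - ∑ j, X j ^ 2) * q ∈ SS s := by
    apply handelman
    intro x hx
    have hev : eval x (p - (1 - ∑ j, X j ^ 2) * q) = eval x p - (1 - ∑ j, x j ^ 2) *
        (η * ((s + ∑ i, x i ^ 2) / (1 + s)) ^ N) := by
      simp [q, hue]
    rw [hev]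
    have hS0 : 0 ≤ ∑ i, x i ^ 2 := Finset.sum_nonneg fun i _ => sq_nonneg _
    have hηp := hηp x hx
    have hM := hM x hx
    have hδp := hδp x hx
    set t := ∑ i, x i ^ 2
    have hv0 : 0 ≤ (s + t) / (1 + s) := by positivity
    have hw0 : 0 ≤ ((s + t) / (1 + s)) ^ N := by positivity
    rcases le_or_gt t 1 with ht | ht
    · have hv1 : ((s + t) / (1 + s)) ^ N ≤ 1 := by
        apply pow_le_one₀ hv0
        rw [div_le_one hs]; linarith
      have h1 := hηp ht
      have : (1 - t) * (η * ((s + t) / (1 + s)) ^ N) ≤ 1 * (η * 1) := by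
        apply mul_le_mul (by linarith) _ (by positivity) (by norm_num)
        exact mul_le_mul_of_nonneg_left hv1 hη.le
      linarith
    · have hz : 0 ≤ η * ((s + t) / (1 + s)) ^ N := by positivity
      rcases lt_or_ge 0 (eval x p) with h | h
      · nlinarith
      · have hδ' := hδp h
        have h1 : ((1 + s + δ) / (1 + s : ℝ)) ^ N ≤ ((s + t) / (1 + s)) ^ N := by
          apply pow_le_pow_left₀ (by positivity)
          apply div_le_div_of_nonneg_right _ hs.le
          linarith
        have h2 : M / (δ * η) < ((s + t) / (1 + s)) ^ N := hN.trans_le h1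
        rw [div_lt_iff₀ (by positivity)] at h2
        have h3 : δ * (η * ((s + t) / (1 + s)) ^ N) ≤ (t - 1) * (η * ((s + t) / (1 + s)) ^ N) :=
          mul_le_mul_of_nonneg_right (by linarith) hz
        nlinarith
  have h1 := RR_SS hpos 0 (by norm_num)
  have h2 := RR_SS hqS 1 le_rfl
  have h3 := RR_add h1 h2
  rw [pow_zero, one_mul, pow_one, sub_add_cancel] at h3
  exact h3
end

section
/- Let A be a unital commutative ℝ-algebra and L : A → ℝ linear with L(1)=1. The following are equivalent: (i) for every a ∈ A, the sequence n ↦ L(aⁿ) admits a representing positive Radon measure on some compact subset of ℝ; (ii) L is positive semidefinite and v_L(a) < ∞ for all a ∈ A; (iii) L admits a unique representing positive Radon measure μ on some compact subset K of X(A). Moreover in this case supp μ ⊆ {α ∈ X(A) : |α(a)| ≤ v_L(a) for all a ∈ A}. -/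
open MeasureTheory

variable {A : Type*} [CommRing A] [Algebra ℝ A]

/-- The set of ratios `L(a^{2n+2})/L(a^{2n})` over `n` with `L(a^{2n}) ≠ 0`. -/
def ratioSet (L : A →ₗ[ℝ] ℝ) (a : A) : Set ℝ :=
  {r | ∃ n : ℕ, L (a ^ (2 * n)) ≠ 0 ∧ r = L (a ^ (2 * n + 2)) / L (a ^ (2 * n))}

/-- `v_L(a) = sqrt( sup_{n, L(a^{2n}) ≠ 0} L(a^{2n+2})/L(a^{2n}) )`. -/
noncomputable def vL (L : A →ₗ[ℝ] ℝ) (a : A) : ℝ :=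
  Real.sqrt (sSup (ratioSet L a))

/-- Cauchy-Schwarz for positive semidefinite functionals. -/
lemma psd_cs (L : A →ₗ[ℝ] ℝ) (hL : ∀ x : A, 0 ≤ L (x ^ 2)) (x y : A) :
    L (x * y) ^ 2 ≤ L (x ^ 2) * L (y ^ 2) := by
  have h : ∀ t : ℝ, 0 ≤ L (y ^ 2) * (t * t) + (2 * L (x * y)) * t + L (x ^ 2) := by
    intro t
    have h1 := hL (x + t • y)
    have h2 : (x + t • y) ^ 2 = x ^ 2 + (2 * t) • (x * y) + (t * t) • y ^ 2 := by
      simp only [Algebra.smul_def, map_mul, map_ofNat]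
      ring
    rw [h2] at h1
    simp only [map_add, map_smul, smul_eq_mul] at h1
    linarith
  have := discrim_le_zero h
  unfold discrim at this
  nlinarith

/-- Growth lemma for log-convex sequences. -/
lemma logconvex_growth (u : ℕ → ℝ) (h0 : ∀ n, 0 ≤ u n)
    (hc : ∀ n, u (n + 1) ^ 2 ≤ u n * u (n + 2)) (C R : ℝ) (hR : 0 ≤ R)
    (hg : ∀ n, u n ≤ C * R ^ n) : u 1 ≤ R * u 0 := by
  by_contra! hlt
  have hu0 : 0 < u 0 := by
    rcases (h0 0).lt_or_eq with h | h
    · exact h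
    · exfalso
      have := hc 0
      rw [← h] at this hlt
      nlinarith
  set q := u 1 / u 0 with hq
  have hqR : R < q := by rw [hq, lt_div_iff₀ hu0]; exact hlt
  have hq0 : 0 < q := lt_of_le_of_lt hR hqR
  have hstep : ∀ n, 0 < u n ∧ q * u n ≤ u (n + 1) := by
    intro n
    induction n with
    | zero => exact ⟨hu0, by rw [hq]; field_simp; simp⟩
    | succ n ih =>
      obtain ⟨ih1, ih2⟩ := ih
      have hp : 0 < u (n + 1) := lt_of_lt_of_le (by positivity) ih2
      refine ⟨hp, ?_⟩
      have h1 := hc n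
      have h2 : u n * (q * u (n + 1)) ≤ u n * u (n + 2) := by nlinarith
      exact le_of_mul_le_mul_left h2 ih1
  have hpow : ∀ n, q ^ n * u 0 ≤ u n := by
    intro n
    induction n with
    | zero => simp
    | succ n ih =>
      have := (hstep n).2
      calc q ^ (n + 1) * u 0 = q * (q ^ n * u 0) := by ring
        _ ≤ q * u n := by gcongr
        _ ≤ _ := this
  have hle : ∀ n, u 0 ≤ C * (R / q) ^ n := by
    intro n
    have h1 := (hpow n).trans (hg n)
    rw [div_pow, ← mul_div_assoc, le_div_iff₀ (by positivity)]
    linarith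
  have ht : Filter.Tendsto (fun n : ℕ => C * (R / q) ^ n) Filter.atTop (nhds (C * 0)) :=
    (tendsto_pow_atTop_nhds_zero_of_lt_one (by positivity) ((div_lt_one hq0).2 hqR)).const_mul C
  have := ge_of_tendsto' ht hle
  linarith

/-- Localized bound. -/
lemma psd_bound (L : A →ₗ[ℝ] ℝ) (hL : ∀ x : A, 0 ≤ L (x ^ 2)) (y : A) (C r : ℝ)
    (hg : ∀ n : ℕ, L (y ^ (2 * n)) ≤ C * r ^ (2 * n)) (b : A) :
    L (y ^ 2 * b ^ 2) ≤ r ^ 2 * L (b ^ 2) := by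
  have hC : 0 ≤ C := by
    have h1 := hg 0
    have h2 := hL 1
    simp at h1 h2
    linarith
  have key := logconvex_growth (fun n => L ((y ^ n * b) ^ 2)) (fun n => hL _) ?_
    (Real.sqrt (L ((b ^ 2) ^ 2) * C)) (r ^ 2) (by positivity) ?_
  · simpa [mul_pow] using key
  · intro n
    have := psd_cs L hL (y ^ n * b) (y ^ (n + 2) * b)
    convert this using 3
    ring_nf
  · intro n
    have h1 := psd_cs L hL (b ^ 2) (y ^ (2 * n))
    have h2 := hg (2 * n)
    have h3 : L ((y ^ n * b) ^ 2) = L (b ^ 2 * y ^ (2 * n)) := by congr 1; ring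
    have h4 : (y ^ (2 * n)) ^ 2 = y ^ (2 * (2 * n)) := by ring
    have h5 := hL (b ^ 2)
    simp only [h3]
    rw [h4] at h1
    refine le_of_abs_le (abs_le_of_sq_le_sq ?_ (by positivity))
    · rw [mul_pow, Real.sq_sqrt (by positivity)]
      calc _ ≤ _ := h1
        _ ≤ L ((b ^ 2) ^ 2) * (C * r ^ (2 * (2 * n))) := by gcongr
        _ = _ := by ring

/-- The convex compact set of states bounded by `v`. -/
def stateSet (A : Type*) [CommRing A] [Algebra ℝ A] (v : A → ℝ) : Set (A → ℝ) :=
  {f | (∀ x y, f (x + y) = f x + f y) ∧ (∀ (c : ℝ) x, f (c • x) = c * f x) ∧ f 1 = 1 ∧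
    (∀ x, 0 ≤ f (x ^ 2)) ∧ ∀ x (n : ℕ), f (x ^ (2 * n)) ≤ v x ^ (2 * n)}

/-- The candidate compact set. -/
def bddChar (A : Type*) [CommRing A] [Algebra ℝ A] (v : A → ℝ) : Set (A → ℝ) :=
  charSet A ∩ {φ | ∀ a, |φ a| ≤ v a}

lemma stateSet_abs_le {v : A → ℝ} (hv : ∀ a, 0 ≤ v a) {f : A → ℝ} (hf : f ∈ stateSet A v) (a : A) :
    |f a| ≤ v a := by
  obtain ⟨h1, h2, h3, h4, h5⟩ := hf
  let L : A →ₗ[ℝ] ℝ := { toFun := f, map_add' := h1, map_smul' := h2 }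
  have h := psd_cs L h4 a 1
  have h6 := h5 a 1
  change f (a * 1) ^ 2 ≤ f (a ^ 2) * f (1 ^ 2) at h
  simp only [mul_one, one_pow, h3] at h h6
  exact abs_le_of_sq_le_sq (h.trans h6) (hv a)

lemma stateSet_compact {v : A → ℝ} (hv : ∀ a, 0 ≤ v a) : IsCompact (stateSet A v) := by
  have hc : IsCompact (Set.univ.pi fun a : A => Set.Icc (-v a) (v a)) :=
    isCompact_univ_pi fun a => isCompact_Icc
  refine hc.of_isClosed_subset ?_ ?_
  · unfold stateSet
    simp only [Set.ofPred_and, Set.ofPred_forall]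
    refine IsClosed.inter ?_ (IsClosed.inter ?_ (IsClosed.inter ?_ (IsClosed.inter ?_ ?_)))
    · exact isClosed_iInter fun x => isClosed_iInter fun y =>
        isClosed_eq (by fun_prop) (by fun_prop)
    · exact isClosed_iInter fun x => isClosed_iInter fun y =>
        isClosed_eq (by fun_prop) (by fun_prop)
    · exact isClosed_eq (by fun_prop) (by fun_prop)
    · exact isClosed_iInter fun x => isClosed_le (by fun_prop) (by fun_prop)
    · exact isClosed_iInter fun x => isClosed_iInter fun y =>
        isClosed_le (by fun_prop) (by fun_prop)
  · intro f hf a _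
    exact abs_le.1 (stateSet_abs_le hv hf a)

lemma bddChar_compact {v : A → ℝ} : IsCompact (bddChar A v) := by
  have hc : IsCompact (Set.univ.pi fun a : A => Set.Icc (-v a) (v a)) :=
    isCompact_univ_pi fun a => isCompact_Icc
  refine hc.of_isClosed_subset ?_ ?_
  · have : bddChar A v = {f | (∀ x y, f (x + y) = f x + f y) ∧ (∀ (c : ℝ) x, f (c • x) = c * f x) ∧
      f 1 = 1 ∧ (∀ x y, f (x * y) = f x * f y) ∧ ∀ x, |f x| ≤ v x} := by
      ext f
      constructor
      · rintro ⟨⟨ψ, rfl⟩, h⟩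
        exact ⟨map_add ψ, by simp, map_one ψ, map_mul ψ, h⟩
      · rintro ⟨h1, h2, h3, h4, h5⟩
        exact ⟨⟨AlgHom.ofLinearMap { toFun := f, map_add' := h1, map_smul' := h2 } h3 h4, rfl⟩, h5⟩
    rw [this]
    simp only [Set.ofPred_and, Set.ofPred_forall]
    refine IsClosed.inter ?_ (IsClosed.inter ?_ (IsClosed.inter ?_ (IsClosed.inter ?_ ?_)))
    · exact isClosed_iInter fun x => isClosed_iInter fun y =>
        isClosed_eq (by fun_prop) (by fun_prop)
    · exact isClosed_iInter fun x => isClosed_iInter fun y =>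
        isClosed_eq (by fun_prop) (by fun_prop)
    · exact isClosed_eq (by fun_prop) (by fun_prop)
    · exact isClosed_iInter fun x => isClosed_iInter fun y =>
        isClosed_eq (by fun_prop) (by fun_prop)
    · exact isClosed_iInter fun x => isClosed_le (by fun_prop) (by fun_prop)
  · intro f hf a _
    exact abs_le.1 (hf.2 a)

lemma stateSet_convex {v : A → ℝ} : Convex ℝ (stateSet A v) := by
  rintro f ⟨f1, f2, f3, f4, f5⟩ g ⟨g1, g2, g3, g4, g5⟩ s t hs ht hst
  refine ⟨fun x y => ?_, fun c x => ?_, ?_, fun x => ?_, fun x n => ?_⟩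
  · simp only [Pi.add_apply, Pi.smul_apply, smul_eq_mul, f1, g1]; ring
  · simp only [Pi.add_apply, Pi.smul_apply, smul_eq_mul, f2, g2]; ring
  · simp only [Pi.add_apply, Pi.smul_apply, smul_eq_mul, f3, g3]; linarith
  · simp only [Pi.add_apply, Pi.smul_apply, smul_eq_mul]
    have := f4 x
    have := g4 x
    positivity
  · simp only [Pi.add_apply, Pi.smul_apply, smul_eq_mul]
    calc s * f (x ^ (2 * n)) + t * g (x ^ (2 * n))
        ≤ s * v x ^ (2 * n) + t * v x ^ (2 * n) := by
          have := f5 x n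
          have := g5 x n
          gcongr
      _ = v x ^ (2 * n) := by rw [← add_mul, hst, one_mul]

lemma stateSet_twist {v : A → ℝ} {f : A → ℝ} (hf : f ∈ stateSet A v)
    (w : A) (M : ℝ) (hw : 0 < f w) (h0 : ∀ b, 0 ≤ f (w * b ^ 2))
    (hM : ∀ b, f (w * b ^ 2) ≤ M * f (b ^ 2)) :
    (fun b => f (w * b) / f w) ∈ stateSet A v := by
  obtain ⟨h1, h2, h3, h4, h5⟩ := hf
  let G : A →ₗ[ℝ] ℝ :=
    { toFun := fun b => f (w * b) / f w
      map_add' := fun x y => by simp only [mul_add, h1, add_div]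
      map_smul' := fun c x => by
        simp only [mul_smul_comm, h2, smul_eq_mul, RingHom.id_apply, mul_div_assoc] }
  have hG : ∀ b, G b = f (w * b) / f w := fun b => rfl
  have hM0 : 0 ≤ M := by
    have h6 := (h0 1).trans (hM 1)
    simpa [h3] using h6
  have hpsd : ∀ x, 0 ≤ G (x ^ 2) := fun x => div_nonneg (h0 x) hw.le
  have hgr : ∀ y (n : ℕ), G (y ^ (2 * n)) ≤ (M / f w) * v y ^ (2 * n) := by
    intro y n
    rw [hG, div_mul_eq_mul_div]
    have h6 := hM (y ^ n)
    have h7 := h5 y n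
    have h8 : (y ^ n) ^ 2 = y ^ (2 * n) := by ring
    rw [h8] at h6
    gcongr
    exact h6.trans (by gcongr)
  have hone : G 1 = 1 := by rw [hG, mul_one]; exact div_self hw.ne'
  refine ⟨G.map_add, G.map_smul, hone, hpsd, fun y n => ?_⟩
  change G _ ≤ _
  induction n with
  | zero => simp [hone]
  | succ n ih =>
    have h6 := psd_bound G hpsd y _ _ (hgr y) (y ^ n)
    have h7 : y ^ 2 * (y ^ n) ^ 2 = y ^ (2 * (n + 1)) := by ring
    have h8 : (y ^ n) ^ 2 = y ^ (2 * n) := by ring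
    rw [h7, h8] at h6
    calc _ ≤ _ := h6
      _ ≤ v y ^ 2 * v y ^ (2 * n) := by gcongr
      _ = _ := by ring

lemma extreme_char {v : A → ℝ} (hv : ∀ a, 0 ≤ v a) {f : A → ℝ}
    (hf : f ∈ (stateSet A v).extremePoints ℝ) : f ∈ bddChar A v := by
  have hfS := hf.1
  refine ⟨?_, stateSet_abs_le hv hfS⟩
  obtain ⟨h1, h2, h3, h4, h5⟩ := hfS
  let L : A →ₗ[ℝ] ℝ := { toFun := f, map_add' := h1, map_smul' := h2 }
  have hLf : ∀ x, L x = f x := fun x => rfl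
  have hmul : ∀ a b, f (a * b) = f a * f b := by
    intro a b
    have hab := abs_le.1 (stateSet_abs_le hv hf.1 a)
    have hva := hv a
    set c := v a + 1 with hc
    have hloc : ∀ b, |f (a * b ^ 2)| ≤ v a * f (b ^ 2) := by
      intro b
      have e1 := psd_cs L h4 (a * b) b
      have e2 := psd_bound L h4 a 1 (v a) (fun n => by rw [one_mul]; exact h5 a n) b
      simp only [hLf] at e1 e2
      have e3 : a * b * b = a * b ^ 2 := by ring
      rw [e3, mul_pow] at e1
      have e4 := h4 b
      apply abs_le_of_sq_le_sq _ (by positivity)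
      calc _ ≤ _ := e1
        _ ≤ v a ^ 2 * f (b ^ 2) * f (b ^ 2) := by gcongr
        _ = _ := by ring
    have e : ∀ (s : ℝ) x, f ((c • (1 : A) + s • a) * x) = c * f x + s * f (a * x) := by
      intro s x
      rw [add_mul, h1, smul_mul_assoc, one_mul, smul_mul_assoc, h2, h2]
    have e' : ∀ (s : ℝ), f (c • (1 : A) + s • a) = c + s * f a := by
      intro s
      rw [h1, h2, h2, h3, mul_one]
    have tw : ∀ s : ℝ, (s = 1 ∨ s = -1) →
        0 < c + s * f a ∧ (fun b => f ((c • (1 : A) + s • a) * b) / f (c • (1 : A) + s • a)) ∈ stateSet A v := by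
      intro s hs
      have hpos : 0 < c + s * f a := by
        rcases hs with rfl | rfl <;> linarith
      refine ⟨hpos, ?_⟩
      apply stateSet_twist hf.1 _ (c + v a)
      · rw [e']; exact hpos
      · intro b
        have := abs_le.1 (hloc b)
        have := h4 b
        rw [e]
        rcases hs with rfl | rfl <;> nlinarith
      · intro b
        have := abs_le.1 (hloc b)
        have := h4 b
        rw [e]
        rcases hs with rfl | rfl <;> nlinarith
    obtain ⟨p1, m1⟩ := tw 1 (Or.inl rfl)
    obtain ⟨p2, m2⟩ := tw (-1) (Or.inr rfl)
    have hcpos : 0 < c := by linarith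
    have := hf.2 m1 m2 (⟨(c + 1 * f a) / (2 * c), (c + -1 * f a) / (2 * c), by positivity, by positivity,
      by field_simp; ring, ?_⟩)
    · have h6 := congrFun this b
      simp only [e, e'] at h6
      rw [div_eq_iff p1.ne'] at h6
      linarith
    · funext x
      simp only [Pi.add_apply, Pi.smul_apply, smul_eq_mul, e, e']
      have q1 := p1.ne'
      have q2 := p2.ne'
      set d1 := c + 1 * f a with hd1
      set d2 := c + -1 * f a with hd2
      field_simp
      ring
  exact ⟨AlgHom.ofLinearMap L h3 hmul, rfl⟩

lemma nonneg_of_bddChar {v : A → ℝ} (hv : ∀ a, 0 ≤ v a) {f : A → ℝ} (hf : f ∈ stateSet A v) (a : A)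
    (ha : ∀ φ ∈ bddChar A v, 0 ≤ φ a) : 0 ≤ f a := by
  rw [← closure_convexHull_extremePoints (stateSet_compact hv) stateSet_convex] at hf
  have hcl : IsClosed {g : A → ℝ | 0 ≤ g a} := isClosed_le (by fun_prop) (by fun_prop)
  have hcv : Convex ℝ {g : A → ℝ | 0 ≤ g a} := by
    intro g hg k hk s t hs ht _
    simp only [Set.mem_ofPred_eq, Pi.add_apply, Pi.smul_apply, smul_eq_mul] at *
    positivity
  exact closure_minimal (convexHull_min (fun g hg => ha g (extreme_char hv hg)) hcv) hcl hf

lemma ratio_bound (L : A →ₗ[ℝ] ℝ) (h1 : L 1 = 1) (hL : ∀ x : A, 0 ≤ L (x ^ 2))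
    (hb : ∀ a : A, BddAbove (ratioSet L a)) : ⇑L ∈ stateSet A (vL L) := by
  refine ⟨map_add L, by simp, h1, hL, fun x n => ?_⟩
  have hmem : L (x ^ 2) ∈ ratioSet L x := ⟨0, by simp [h1], by simp [h1]⟩
  have hs : 0 ≤ sSup (ratioSet L x) := (hL x).trans (le_csSup (hb x) hmem)
  have hsq : vL L x ^ 2 = sSup (ratioSet L x) := Real.sq_sqrt hs
  rw [pow_mul (vL L x), hsq]
  induction n with
  | zero => simp [h1]
  | succ n ih =>
    have hstep : L (x ^ (2 * n + 2)) ≤ sSup (ratioSet L x) * L (x ^ (2 * n)) := by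
      have h0 : 0 ≤ L (x ^ (2 * n)) := by
        have := hL (x ^ n)
        rwa [← pow_mul, mul_comm n 2] at this
      rcases h0.lt_or_eq with h | h
      · rw [← div_le_iff₀ h]
        exact le_csSup (hb x) ⟨n, h.ne', rfl⟩
      · have e := psd_cs L hL (x ^ n) (x ^ (n + 2))
        have e1 : (x ^ n) ^ 2 = x ^ (2 * n) := by ring
        have e2 : x ^ n * x ^ (n + 2) = x ^ (2 * n + 2) := by ring
        rw [e1, e2, ← h, zero_mul] at e
        rw [← h, mul_zero]
        nlinarith
    calc L (x ^ (2 * (n + 1))) = L (x ^ (2 * n + 2)) := by congr 1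
      _ ≤ _ := hstep
      _ ≤ sSup (ratioSet L x) * sSup (ratioSet L x) ^ n := by gcongr
      _ = _ := by ring

open scoped CompactlySupported in
/-- Riesz representation for a functional positive on a family of continuous functions. -/
lemma exists_measure_of_pos {X : Type*} [TopologicalSpace X] [CompactSpace X] [T2Space X]
    [MeasurableSpace X] [BorelSpace X] (L : A →ₗ[ℝ] ℝ) (e : A →ₗ[ℝ] C(X, ℝ))
    (he : e 1 = 1) (hpos : ∀ a, (∀ x, 0 ≤ e a x) → 0 ≤ L a) :
    ∃ μ : Measure X, IsFiniteMeasure μ ∧ ∀ a, L a = ∫ x, e a x ∂μ := by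
  have hker : ∀ a b, e a = e b → L a = L b := by
    intro a b h
    apply le_antisymm
    · have := hpos (b - a) (by simp [h])
      simp at this; linarith
    · have := hpos (a - b) (by simp [h])
      simp at this; linarith
  obtain ⟨g, hg⟩ := e.rangeRestrict.exists_rightInverse_of_surjective e.range_rangeRestrict
  have hg' : ∀ y : LinearMap.range e, e (g y) = y := by
    intro y
    have := LinearMap.congr_fun hg y
    exact congrArg Subtype.val this
  let s : PointedCone ℝ C(X, ℝ) :=
    { carrier := {f | ∀ x, 0 ≤ f x}
      add_mem' := fun {f g} hf hg x => add_nonneg (hf x) (hg x)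
      zero_mem' := fun x => le_rfl
      smul_mem' := fun c f hf x => mul_nonneg c.2 (hf x) }
  let F : C(X, ℝ) →ₗ.[ℝ] ℝ := ⟨LinearMap.range e, L.comp g⟩
  obtain ⟨Λ, hΛ1, hΛ2⟩ := riesz_extension s F
    (by
      intro x hx
      refine hpos (g x) ?_
      rw [hg' x]
      exact hx)
    (by
      intro y
      refine ⟨⟨e (‖y‖ • 1), LinearMap.mem_range_self e _⟩, ?_⟩
      intro x
      have := y.norm_coe_le_norm x
      rw [Real.norm_eq_abs] at this
      have := neg_abs_le (y x)
      simp [he]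
      linarith)
  have hΛL : ∀ a, Λ (e a) = L a := by
    intro a
    have h1 := hΛ1 ⟨e a, LinearMap.mem_range_self e a⟩
    refine h1.trans ?_
    exact hker _ _ (hg' ⟨e a, LinearMap.mem_range_self e a⟩)
  let Λ' : C_c(X, ℝ) →ₗ[ℝ] ℝ :=
    { toFun := fun f => Λ (f : C(X, ℝ))
      map_add' := fun f g => Λ.map_add _ _
      map_smul' := fun c f => Λ.map_smul _ _ }
  let P : C_c(X, ℝ) →ₚ[ℝ] ℝ := PositiveLinearMap.mk₀ Λ' (fun f hf => hΛ2 _ hf)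
  refine ⟨RealRMK.rieszMeasure P, ?_, ?_⟩
  · exact isFiniteMeasure_iff_isFiniteMeasureOnCompacts_of_compactSpace.2 inferInstance
  · intro a
    have := RealRMK.integral_rieszMeasure P (CompactlySupportedContinuousMap.continuousMapEquiv (e a))
    rw [← hΛL]
    exact this.symm

lemma exists_repr (K : Set (A → ℝ)) (hK : IsCompact K) (hKc : K ⊆ charSet A) (L : A →ₗ[ℝ] ℝ)
    (hpos : ∀ a, (∀ φ ∈ K, 0 ≤ φ a) → 0 ≤ L a) :
    ∃ μ : Measure K, IsFiniteMeasure μ ∧ ∀ a : A, L a = ∫ φ, (φ : A → ℝ) a ∂μ := by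
  have : CompactSpace K := isCompact_iff_compactSpace.1 hK
  let e : A →ₗ[ℝ] C(K, ℝ) :=
    { toFun := fun a => ⟨fun φ => (φ : A → ℝ) a, (continuous_apply a).comp continuous_subtype_val⟩
      map_add' := fun a b => by
        ext ⟨φ, hφ⟩
        obtain ⟨ψ, rfl⟩ := hKc hφ
        simp
      map_smul' := fun a b => by
        ext ⟨φ, hφ⟩
        obtain ⟨ψ, rfl⟩ := hKc hφ
        simp }
  have he : e 1 = 1 := by
    ext ⟨φ, hφ⟩
    obtain ⟨ψ, rfl⟩ := hKc hφ
    simp [e]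
  obtain ⟨μ, hμ, hμL⟩ := @exists_measure_of_pos A _ _ K _ _ _ (borel K) (@BorelSpace.mk K _ (borel K) rfl) L e he
    (fun a ha => hpos a fun φ hφ => ha ⟨φ, hφ⟩)
  have hle : (Subtype.instMeasurableSpace : MeasurableSpace K) ≤ borel K := by
    rintro s ⟨t, ht, rfl⟩
    have hid : @Measurable K (A → ℝ) (borel K) _ Subtype.val := by
      refine @measurable_pi_lambda _ _ _ (borel K) _ _ (fun a => ?_)
      let _ : MeasurableSpace K := borel K
      have : BorelSpace K := ⟨rfl⟩
      exact Continuous.measurable ((continuous_apply a).comp continuous_subtype_val)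
    exact hid ht
  refine ⟨@Measure.trim K _ (borel K) μ hle, ?_, fun a => ?_⟩
  · exact @isFiniteMeasure_trim K _ (borel K) μ hle hμ
  · rw [hμL]
    exact integral_trim hle
      (((measurable_pi_apply a).comp measurable_subtype_coe).stronglyMeasurable)

lemma compact_bound {K : Set (A → ℝ)} (hK : IsCompact K) (a : A) :
    ∃ C : ℝ, 0 ≤ C ∧ ∀ φ ∈ K, |φ a| ≤ C := by
  obtain ⟨C, hC⟩ := hK.exists_bound_of_continuousOn (f := fun φ : A → ℝ => φ a) (by fun_prop)
  exact ⟨max C 0, le_max_right _ _, fun φ hφ => (hC φ hφ).trans (le_max_left _ _)⟩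

lemma meas_eval (K : Set (A → ℝ)) (a : A) : Measurable (fun φ : K => (φ : A → ℝ) a) :=
  (measurable_pi_apply a).comp measurable_subtype_coe

lemma integral_exp_eq (K : Set (A → ℝ)) (hK : IsCompact K) (hKc : K ⊆ charSet A) (L : A →ₗ[ℝ] ℝ)
    (μ : Measure K) [IsFiniteMeasure μ] (hμ : ∀ a : A, L a = ∫ φ, (φ : A → ℝ) a ∂μ) (a : A) :
    ∫ φ, Complex.exp (((φ : A → ℝ) a : ℂ) * Complex.I) ∂μ =
      ∑' n : ℕ, (Complex.I ^ n / (n.factorial : ℂ)) * (L (a ^ n) : ℂ) := by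
  obtain ⟨C, hC0, hC⟩ := compact_bound hK a
  have h := hasSum_integral_of_dominated_convergence (μ := μ)
    (F := fun (n : ℕ) (φ : K) => (Complex.I ^ n / (n.factorial : ℂ)) * (((φ : A → ℝ) (a ^ n) : ℝ) : ℂ))
    (f := fun φ => Complex.exp (((φ : A → ℝ) a : ℂ) * Complex.I))
    (fun n _ => C ^ n / n.factorial) ?_ ?_ ?_ ?_ ?_
  · rw [← h.tsum_eq]
    congr 1
    funext n
    rw [integral_const_mul, hμ]
    congr 1
    exact integral_ofReal
  · intro n
    refine Measurable.aestronglyMeasurable ?_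
    exact (Complex.measurable_ofReal.comp (meas_eval K (a ^ n))).const_mul _
  · intro n
    refine Filter.Eventually.of_forall fun φ => ?_
    obtain ⟨ψ, hψ⟩ := hKc φ.2
    have h1 := hC φ.1 φ.2
    rw [← hψ] at h1 ⊢
    rw [map_pow]
    simp only [norm_mul, norm_div, norm_pow, Complex.norm_I, one_pow, Complex.norm_natCast,
      Complex.norm_real, Real.norm_eq_abs, Complex.ofReal_pow]
    rw [div_mul_eq_mul_div, one_mul]
    gcongr
  · exact Filter.Eventually.of_forall fun φ => Real.summable_pow_div_factorial C
  · exact integrable_const _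
  · refine Filter.Eventually.of_forall fun φ => ?_
    obtain ⟨ψ, hψ⟩ := hKc φ.2
    have h1 := NormedSpace.expSeries_div_hasSum_exp (𝔸 := ℂ) (((φ : A → ℝ) a : ℂ) * Complex.I)
    rw [← Complex.exp_eq_exp_ℂ] at h1
    have h2 : (fun n : ℕ => (Complex.I ^ n / (n.factorial : ℂ)) * (((φ : A → ℝ) (a ^ n) : ℝ) : ℂ)) =
        fun n : ℕ => (((φ : A → ℝ) a : ℂ) * Complex.I) ^ n / (n.factorial : ℂ) := by
      funext n
      rw [← hψ, map_pow, mul_pow]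
      push_cast
      ring
    rw [h2]
    exact h1

lemma repr_unique (K : Set (A → ℝ)) (hK : IsCompact K) (hKc : K ⊆ charSet A) (L : A →ₗ[ℝ] ℝ)
    (μ ν : Measure K) [IsFiniteMeasure μ] [IsFiniteMeasure ν]
    (hμ : ∀ a : A, L a = ∫ φ, (φ : A → ℝ) a ∂μ)
    (hν : ∀ a : A, L a = ∫ φ, (φ : A → ℝ) a ∂ν) : μ = ν := by
  classical
  have hchar : ∀ (I : Finset A) (ρ : Measure K) [IsFiniteMeasure ρ],
      (∀ a : A, L a = ∫ φ, (φ : A → ℝ) a ∂ρ) → ∀ T : StrongDual ℝ (I → ℝ),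
      charFunDual ((ρ.map Subtype.val).map I.restrict) T =
        ∑' n : ℕ, (Complex.I ^ n / (n.factorial : ℂ)) *
          (L ((∑ i : I, T (Pi.single i 1) • (i : A)) ^ n) : ℂ) := by
    intro I ρ _ hρ T
    rw [← integral_exp_eq K hK hKc L ρ hρ, charFunDual_apply,
      integral_map (Finset.measurable_restrict I).aemeasurable, 
      integral_map measurable_subtype_coe.aemeasurable]
    · congr 1
      funext φ
      obtain ⟨ψ, hψ⟩ := hKc φ.2
      congr 3
      rw [← hψ, map_sum]
      have : I.restrict ⇑ψ = ∑ i : I, (ψ i) • (Pi.single i (1 : ℝ) : I → ℝ) := by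
        ext j
        simp [Finset.sum_apply, Pi.single_apply]
      rw [this, map_sum]
      simp [mul_comm]
    · refine Measurable.aestronglyMeasurable ?_
      have := T.continuous.measurable
      have := Finset.measurable_restrict (X := fun _ : A => ℝ) I
      fun_prop
    · refine Measurable.aestronglyMeasurable ?_
      have := T.continuous.measurable
      fun_prop
  have hmap : μ.map Subtype.val = ν.map Subtype.val := by
    refine IsProjectiveLimit.unique (P := fun I => (μ.map Subtype.val).map I.restrict)
      (fun I => rfl) (fun I => ?_)
    refine Measure.ext_of_charFunDual ?_
    funext T
    rw [hchar I μ hμ T, hchar I ν hν T]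
  ext s hs
  obtain ⟨t, ht, rfl⟩ := hs
  rw [← Measure.map_apply measurable_subtype_coe ht, hmap,
    Measure.map_apply measurable_subtype_coe ht]

lemma bdd_of_measure {X : Type*} [MeasurableSpace X] (μ : Measure X) [IsFiniteMeasure μ]
    (L : A →ₗ[ℝ] ℝ) (a : A) (u : X → ℝ) (hu : Measurable u) (C : ℝ) (hC : ∀ᵐ x ∂μ, |u x| ≤ C)
    (h : ∀ n : ℕ, L (a ^ n) = ∫ x, u x ^ n ∂μ) :
    0 ≤ L (a ^ 2) ∧ BddAbove (ratioSet L a) := by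
  have hint : ∀ n : ℕ, Integrable (fun x => u x ^ n) μ := by
    intro n
    refine Integrable.of_bound (by fun_prop) (C ^ n) ?_
    filter_upwards [hC] with x hx
    rw [norm_pow, Real.norm_eq_abs]
    gcongr
  have hnn : ∀ n : ℕ, 0 ≤ L (a ^ (2 * n)) := by
    intro n
    rw [h]
    refine integral_nonneg fun x => ?_
    simp only [pow_mul, Pi.zero_apply]
    positivity
  refine ⟨by simpa using hnn 1, C ^ 2, ?_⟩
  rintro r ⟨n, hn, rfl⟩
  rw [div_le_iff₀ (lt_of_le_of_ne (hnn n) hn.symm), h, h, ← integral_const_mul]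
  refine integral_mono_ae (hint _) ((hint _).const_mul _) ?_
  filter_upwards [hC] with x hx
  have h1 : u x ^ 2 ≤ C ^ 2 := by
    rw [← sq_abs (u x)]
    gcongr
  have h2 : 0 ≤ u x ^ (2 * n) := by rw [pow_mul]; positivity
  rw [pow_add, mul_comm]
  gcongr

theorem stmt12 (hX : Nonempty (A →ₐ[ℝ] ℝ)) (L : A →ₗ[ℝ] ℝ) (h1 : L 1 = 1) :
    ((∀ a : A, ∃ Ka : Set ℝ, IsCompact Ka ∧ ∃ μ : Measure ℝ,
        IsFiniteMeasure μ ∧ μ Kaᶜ = 0 ∧ ∀ n : ℕ, L (a ^ n) = ∫ x, x ^ n ∂μ) ↔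
      ((∀ x : A, 0 ≤ L (x ^ 2)) ∧ ∀ a : A, BddAbove (ratioSet L a))) ∧
    (((∀ x : A, 0 ≤ L (x ^ 2)) ∧ ∀ a : A, BddAbove (ratioSet L a)) ↔
      (∃ K : Set (A → ℝ), K ⊆ charSet A ∧ IsCompact K ∧
        ∃! μ : Measure K, IsFiniteMeasure μ ∧ ∀ a : A, L a = ∫ φ, (φ : A → ℝ) a ∂μ)) ∧
    (((∀ x : A, 0 ≤ L (x ^ 2)) ∧ ∀ a : A, BddAbove (ratioSet L a)) →
      ∃ K : Set (A → ℝ), K ⊆ charSet A ∧ IsCompact K ∧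
        K ⊆ {φ : A → ℝ | ∀ a : A, |φ a| ≤ vL L a} ∧
        ∃! μ : Measure K, IsFiniteMeasure μ ∧ ∀ a : A, L a = ∫ φ, (φ : A → ℝ) a ∂μ) := by
  have h3 : ((∀ x : A, 0 ≤ L (x ^ 2)) ∧ ∀ a : A, BddAbove (ratioSet L a)) →
      ∃ K : Set (A → ℝ), K ⊆ charSet A ∧ IsCompact K ∧
        K ⊆ {φ : A → ℝ | ∀ a : A, |φ a| ≤ vL L a} ∧
        ∃! μ : Measure K, IsFiniteMeasure μ ∧ ∀ a : A, L a = ∫ φ, (φ : A → ℝ) a ∂μ := by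
    rintro ⟨hp, hb⟩
    have hS := ratio_bound L h1 hp hb
    have hv : ∀ a, 0 ≤ vL L a := fun a => Real.sqrt_nonneg _
    refine ⟨bddChar A (vL L), Set.inter_subset_left, bddChar_compact, Set.inter_subset_right, ?_⟩
    obtain ⟨μ, hμ, hμL⟩ := exists_repr (bddChar A (vL L)) bddChar_compact Set.inter_subset_left L
      (fun a ha => nonneg_of_bddChar hv hS a ha)
    refine ⟨μ, ⟨hμ, hμL⟩, ?_⟩
    rintro ν ⟨hν, hνL⟩
    exact repr_unique _ bddChar_compact Set.inter_subset_left L ν μ hνL hμL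
  refine ⟨⟨?_, ?_⟩, ⟨fun h => ?_, ?_⟩, h3⟩
  · intro h
    have key : ∀ a : A, 0 ≤ L (a ^ 2) ∧ BddAbove (ratioSet L a) := by
      intro a
      obtain ⟨Ka, hKa, μ, hμ, hμK, hμL⟩ := h a
      obtain ⟨C, hC⟩ := hKa.isBounded.exists_norm_le
      refine bdd_of_measure μ L a (fun x => x) measurable_id C ?_ hμL
      have : ∀ᵐ x ∂μ, x ∈ Ka := by
        rw [ae_iff]; exact hμK
      filter_upwards [this] with x hx using hC x hx
    exact ⟨fun a => (key a).1, fun a => (key a).2⟩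
  · intro h a
    obtain ⟨K, hKc, hK, hKv, μ, ⟨hμ, hμL⟩, -⟩ := h3 h
    have hm := meas_eval K a
    refine ⟨Set.Icc (-vL L a) (vL L a), isCompact_Icc, μ.map (fun φ : K => (φ : A → ℝ) a),
      inferInstance, ?_, fun n => ?_⟩
    · rw [Measure.map_apply hm measurableSet_Icc.compl]
      convert measure_empty (μ := μ)
      ext φ
      simpa using abs_le.1 (hKv φ.2 a)
    · rw [integral_map hm.aemeasurable (by fun_prop), hμL]
      congr 1
      funext φ
      obtain ⟨ψ, hψ⟩ := hKc φ.2
      rw [← hψ, map_pow]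
  · obtain ⟨K, hKc, hK, -, hμ⟩ := h3 h
    exact ⟨K, hKc, hK, hμ⟩
  · rintro ⟨K, hKc, hK, μ, ⟨hμ, hμL⟩, -⟩
    have key : ∀ a : A, 0 ≤ L (a ^ 2) ∧ BddAbove (ratioSet L a) := by
      intro a
      obtain ⟨C, -, hC⟩ := compact_bound hK a
      refine bdd_of_measure μ L a (fun φ : K => (φ : A → ℝ) a) (meas_eval K a) C
        (Filter.Eventually.of_forall fun φ => hC φ.1 φ.2) fun n => ?_
      rw [hμL]
      congr 1
      funext φ
      obtain ⟨ψ, hψ⟩ := hKc φ.2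
      rw [← hψ, map_pow]
    exact ⟨fun a => (key a).1, fun a => (key a).2⟩
end

section
/- Let A be a unital commutative ℝ-algebra with generators a₁,…,a_m and L : A → ℝ positive semidefinite linear with L(1)=1. Then L has a representing positive Radon measure μ with compact support in X(A) if and only if v_L(a₁² + ⋯ + a_m²) < ∞; moreover supp μ ⊆ {α ∈ X(A) : |α(a₁)|² + ⋯ + |α(a_m)|² ≤ v_L(a₁² + ⋯ + a_m²)}. -/
open MeasureTheory

variable {A : Type*} [CommRing A] [Algebra ℝ A]

lemma cs_aux (L : A →ₗ[ℝ] ℝ) (hpsd : ∀ x : A, 0 ≤ L (x ^ 2)) (x y : A) :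
    L (x * y) ^ 2 ≤ L (x ^ 2) * L (y ^ 2) := by
  have key : ∀ t : ℝ, 0 ≤ L (x ^ 2) * (t * t) + (2 * L (x * y)) * t + L (y ^ 2) := by
    intro t
    have h := hpsd (t • x + y)
    have e : (t • x + y) ^ 2 = (t * t) • x ^ 2 + (2 * t) • (x * y) + y ^ 2 := by
      simp only [Algebra.smul_def, map_mul, map_ofNat]
      ring
    rw [e] at h
    simp only [map_add, map_smul, smul_eq_mul] at h
    linarith
  have := discrim_le_zero key
  rw [discrim] at this
  nlinarith

/-- Real growth lemma. -/
lemma growth_aux (r v D : ℝ) (hv : 0 ≤ v) (h : ∀ k : ℕ, r ^ (2 ^ k) ≤ D * v ^ (2 ^ k)) : r ≤ v := by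
  by_contra! hlt
  have hr : 0 < r := lt_of_le_of_lt hv hlt
  have h1 : v / r < 1 := (div_lt_one hr).2 hlt
  have ht : Filter.Tendsto (fun k : ℕ => D * (v / r) ^ (2 ^ k)) Filter.atTop (nhds (D * 0)) :=
    ((tendsto_pow_atTop_nhds_zero_of_lt_one (by positivity) h1).comp
      (tendsto_pow_atTop_atTop_of_one_lt (by norm_num : 1 < 2))).const_mul D
  have : (1 : ℝ) ≤ D * 0 := by
    refine ge_of_tendsto' ht fun k => ?_
    rw [div_pow, mul_div_assoc', le_div_iff₀ (by positivity), one_mul]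
    exact h k
  linarith

lemma pow_bound (L : A →ₗ[ℝ] ℝ) (hpsd : ∀ x : A, 0 ≤ L (x ^ 2)) (h1 : L 1 = 1) (a : A)
    (hb : BddAbove (ratioSet L a)) (n : ℕ) : L (a ^ (2 * n)) ≤ vL L a ^ (2 * n) := by
  have hnn : ∀ r ∈ ratioSet L a, 0 ≤ r := by
    rintro r ⟨n, -, rfl⟩
    apply div_nonneg
    · have := hpsd (a ^ (n + 1)); rwa [← pow_mul, show (n + 1) * 2 = 2 * n + 2 by ring] at this
    · have := hpsd (a ^ n); rwa [← pow_mul, mul_comm] at this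
  have hv2 : vL L a ^ 2 = sSup (ratioSet L a) := Real.sq_sqrt (Real.sSup_nonneg hnn)
  induction n with
  | zero => simp [h1]
  | succ n ih =>
    have hn : 0 ≤ L (a ^ (2 * n)) := by
      have := hpsd (a ^ n); rwa [← pow_mul, mul_comm] at this
    have step : L (a ^ (2 * n + 2)) ≤ vL L a ^ 2 * L (a ^ (2 * n)) := by
      by_cases h0 : L (a ^ (2 * n)) = 0
      · have := cs_aux L hpsd (a ^ n) (a ^ (n + 2))
        rw [← pow_mul, mul_comm n 2, h0, zero_mul, ← pow_add,
          show n + (n + 2) = 2 * n + 2 by ring] at this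
        have h3 : L (a ^ (2 * n + 2)) = 0 := by nlinarith
        rw [h3, h0]; simp
      · have hpos : 0 < L (a ^ (2 * n)) := lt_of_le_of_ne hn (Ne.symm h0)
        have := le_csSup hb ⟨n, h0, rfl⟩
        rw [hv2]
        rwa [div_le_iff₀ hpos] at this
    calc L (a ^ (2 * (n + 1))) = L (a ^ (2 * n + 2)) := by ring_nf
      _ ≤ vL L a ^ 2 * L (a ^ (2 * n)) := step
      _ ≤ vL L a ^ 2 * vL L a ^ (2 * n) := by gcongr
      _ = _ := by ring

lemma mod_bound (L : A →ₗ[ℝ] ℝ) (hpsd : ∀ x : A, 0 ≤ L (x ^ 2)) (a : A) (v : ℝ) (hv : 0 ≤ v)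
    (hb : ∀ n : ℕ, L (a ^ (2 * n)) ≤ v ^ (2 * n)) (b : A) : L (a * b ^ 2) ≤ v * L (b ^ 2) := by
  set s := L (b ^ 2) with hs
  have hs0 : 0 ≤ s := hpsd b
  have hstep : ∀ k : ℕ, L (a ^ (2 ^ k) * b ^ 2) ^ 2 ≤ s * L (a ^ (2 ^ (k + 1)) * b ^ 2) := by
    intro k
    have := cs_aux L hpsd b (a ^ (2 ^ k) * b)
    rw [show b * (a ^ (2 ^ k) * b) = a ^ (2 ^ k) * b ^ 2 by ring,
      show (a ^ (2 ^ k) * b) ^ 2 = a ^ (2 ^ (k + 1)) * b ^ 2 by ring] at this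
    exact this
  have hD : ∀ k : ℕ, L (a ^ (2 ^ k) * b ^ 2) ≤ Real.sqrt (L ((b ^ 2) ^ 2)) * v ^ (2 ^ k) := by
    intro k
    have h := cs_aux L hpsd (b ^ 2) (a ^ (2 ^ k))
    have h2 : L ((a ^ (2 ^ k)) ^ 2) ≤ (v ^ (2 ^ k)) ^ 2 := by
      have := hb (2 ^ k)
      rw [← pow_mul, ← pow_mul, mul_comm _ 2]; exact this
    rw [mul_comm] at h
    have h4 := hpsd (b ^ 2)
    apply le_of_sq_le_sq _ (by positivity)
    rw [mul_pow, Real.sq_sqrt h4]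
    exact h.trans (by gcongr)
  rcases hs0.eq_or_lt with h0 | hpos
  · have := hstep 0
    rw [← h0] at this
    simp only [pow_zero, pow_one, zero_mul] at this
    have h3 : L (a * b ^ 2) = 0 := by nlinarith
    rw [h3, ← h0]; simp
  · by_cases hneg : L (a * b ^ 2) < 0
    · exact hneg.le.trans (by positivity)
    push Not at hneg
    have hr : ∀ k : ℕ, (L (a * b ^ 2) / s) ^ (2 ^ k) ≤ L (a ^ (2 ^ k) * b ^ 2) / s := by
      intro k
      induction k with
      | zero => simp
      | succ k ih =>
        calc (L (a * b ^ 2) / s) ^ (2 ^ (k + 1)) = ((L (a * b ^ 2) / s) ^ (2 ^ k)) ^ 2 := by ring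
          _ ≤ (L (a ^ (2 ^ k) * b ^ 2) / s) ^ 2 := by gcongr
          _ ≤ _ := by
            rw [div_pow, div_le_div_iff₀ (by positivity) hpos]
            nlinarith [hstep k]
    have := growth_aux (L (a * b ^ 2) / s) v (Real.sqrt (L ((b ^ 2) ^ 2)) / s) hv (by
      intro k
      refine (hr k).trans ?_
      rw [div_mul_eq_mul_div]
      gcongr
      exact hD k)
    rwa [div_le_iff₀ hpos] at this

/-- The cone of functionals nonnegative on the quadratic module generated by `v - a`. -/
def QM (v : ℝ) (a : A) : Set (A →ₗ[ℝ] ℝ) :=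
  {M | (∀ b : A, 0 ≤ M (b ^ 2)) ∧ ∀ b : A, M (a * b ^ 2) ≤ v * M (b ^ 2)}

lemma QM_arch {m : ℕ} (a : Fin m → A) (hgen : Algebra.adjoin ℝ (Set.range a) = ⊤)
    (v : ℝ) (x : A) :
    ∃ C : ℝ, 0 ≤ C ∧ ∀ M ∈ QM v (∑ i, a i ^ 2), ∀ c : A, M (x ^ 2 * c ^ 2) ≤ C * M (c ^ 2) := by
  have hx : x ∈ Algebra.adjoin ℝ (Set.range a) := by rw [hgen]; trivial
  induction hx using Algebra.adjoin_induction with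
  | mem x hx =>
    obtain ⟨i, rfl⟩ := hx
    refine ⟨|v|, abs_nonneg v, fun M hM c => ?_⟩
    have h1 := hM.2 c
    have h2 : M (a i ^ 2 * c ^ 2) ≤ M ((∑ i, a i ^ 2) * c ^ 2) := by
      rw [Finset.sum_mul, map_sum]
      refine Finset.single_le_sum (f := fun i => M (a i ^ 2 * c ^ 2)) (fun j _ => ?_)
        (Finset.mem_univ i)
      simp only [← mul_pow]
      exact hM.1 _
    exact h2.trans (h1.trans (mul_le_mul_of_nonneg_right (le_abs_self v) (hM.1 c)))
  | algebraMap r =>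
    refine ⟨r ^ 2, sq_nonneg r, fun M hM c => ?_⟩
    rw [← map_pow, ← Algebra.smul_def, map_smul, smul_eq_mul]
  | add x y _ _ hx hy =>
    obtain ⟨C, hC, h⟩ := hx
    obtain ⟨D, hD, h'⟩ := hy
    refine ⟨2 * C + 2 * D, by positivity, fun M hM c => ?_⟩
    have e : M ((x + y) ^ 2 * c ^ 2) + M (((x - y) * c) ^ 2)
        = M (x ^ 2 * c ^ 2) + M (x ^ 2 * c ^ 2) + M (y ^ 2 * c ^ 2) + M (y ^ 2 * c ^ 2) := by
      simp only [← map_add]; congr 1; ring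
    have := hM.1 ((x - y) * c)
    linarith [h M hM c, h' M hM c]
  | mul x y _ _ hx hy =>
    obtain ⟨C, hC, h⟩ := hx
    obtain ⟨D, hD, h'⟩ := hy
    refine ⟨C * D, by positivity, fun M hM c => ?_⟩
    have h3 := h M hM (y * c)
    rw [show (x * y) ^ 2 * c ^ 2 = x ^ 2 * (y * c) ^ 2 by ring]
    rw [mul_pow] at h3 ⊢
    refine h3.trans ?_
    rw [mul_assoc]
    exact mul_le_mul_of_nonneg_left (h' M hM c) hC

/-- Normalized functionals, as functions. -/
def QS (v : ℝ) (a : A) : Set (A → ℝ) := {f | ∃ M ∈ QM v a, M 1 = 1 ∧ ⇑M = f}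

lemma QS_eq (v : ℝ) (a : A) : QS v a = {f : A → ℝ | (∀ x y, f (x + y) = f x + f y) ∧
    (∀ (c : ℝ) x, f (c • x) = c * f x) ∧ (∀ b, 0 ≤ f (b ^ 2)) ∧
    (∀ b, f (a * b ^ 2) ≤ v * f (b ^ 2)) ∧ f 1 = 1} := by
  ext f
  constructor
  · rintro ⟨M, hM, h1, rfl⟩
    exact ⟨map_add M, fun c x => by simp, hM.1, hM.2, h1⟩
  · rintro ⟨h1, h2, h3, h4, h5⟩
    exact ⟨{ toFun := f, map_add' := h1, map_smul' := h2 }, ⟨h3, h4⟩, h5, rfl⟩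

lemma QS_closed (v : ℝ) (a : A) : IsClosed (QS v a) := by
  rw [QS_eq]
  simp only [Set.ofPred_and, Set.ofPred_forall]
  refine IsClosed.inter ?_ (IsClosed.inter ?_ (IsClosed.inter ?_ (IsClosed.inter ?_ ?_)))
  · exact isClosed_iInter fun x => isClosed_iInter fun y =>
      isClosed_eq (by fun_prop) (by fun_prop)
  · exact isClosed_iInter fun x => isClosed_iInter fun y =>
      isClosed_eq (by fun_prop) (by fun_prop)
  · exact isClosed_iInter fun x => isClosed_le (by fun_prop) (by fun_prop)
  · exact isClosed_iInter fun x => isClosed_le (by fun_prop) (by fun_prop)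
  · exact isClosed_eq (by fun_prop) (by fun_prop)

lemma QS_convex (v : ℝ) (a : A) : Convex ℝ (QS v a) := by
  rintro f ⟨M, hM, hM1, rfl⟩ g ⟨N, hN, hN1, rfl⟩ s t hs ht hst
  refine ⟨s • M + t • N, ⟨fun b => ?_, fun b => ?_⟩, ?_, rfl⟩
  · have := hM.1 b
    have := hN.1 b
    simp only [LinearMap.add_apply, LinearMap.smul_apply, smul_eq_mul]
    positivity
  · have h1 := mul_le_mul_of_nonneg_left (hM.2 b) hs
    have h2 := mul_le_mul_of_nonneg_left (hN.2 b) ht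
    simp only [LinearMap.add_apply, LinearMap.smul_apply, smul_eq_mul]
    linarith
  · simp [hM1, hN1, hst]

lemma QS_compact {m : ℕ} (a : Fin m → A) (hgen : Algebra.adjoin ℝ (Set.range a) = ⊤)
    (v : ℝ) : IsCompact (QS v (∑ i, a i ^ 2)) := by
  choose C hC0 hC using QM_arch a hgen v
  refine (isCompact_univ_pi (fun x : A => isCompact_Icc (a := -(1 + C x)) (b := 1 + C x))).of_isClosed_subset
    (QS_closed _ _) ?_
  rintro f ⟨M, hM, hM1, rfl⟩ x -
  have h1 := hC x M hM 1
  have h2 := cs_aux M hM.1 x 1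
  simp only [one_pow, mul_one, hM1] at h1 h2
  have := hC0 x
  constructor <;> nlinarith

lemma QS_extreme {m : ℕ} (a : Fin m → A) (hgen : Algebra.adjoin ℝ (Set.range a) = ⊤)
    (v : ℝ) (f : A → ℝ) (hf : f ∈ (QS v (∑ i, a i ^ 2)).extremePoints ℝ) : f ∈ charSet A := by
  obtain ⟨⟨L, hL, hL1, rfl⟩, hext⟩ := hf
  set q := ∑ i, a i ^ 2 with hq
  -- the twisted functional
  have hL' : L ∘ₗ LinearMap.mulLeft ℝ (v • (1 : A) - q) ∈ QM v q := by
    refine ⟨fun b => ?_, fun b => ?_⟩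
    · have := hL.2 b
      simp only [LinearMap.comp_apply, LinearMap.mulLeft_apply, sub_mul, map_sub, smul_mul_assoc,
        one_mul, map_smul, smul_eq_mul]
      linarith
    · have := hL.1 ((v • (1 : A) - q) * b)
      have e : ((v • (1 : A) - q) * b) ^ 2
          = v • ((v • (1 : A) - q) * b ^ 2) - (v • (1 : A) - q) * (q * b ^ 2) := by
        simp only [Algebra.smul_def]; ring
      rw [e, map_sub, map_smul, smul_eq_mul] at this
      simp only [LinearMap.comp_apply, LinearMap.mulLeft_apply]
      linarith
  have key : ∀ b x : A, L (b ^ 2 * x) = L (b ^ 2) * L x := by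
    intro b
    obtain ⟨C, hC0, hC⟩ := QM_arch a hgen v b
    have ht0 : 0 ≤ L (b ^ 2) := hL.1 b
    set t := L (b ^ 2) with ht
    have htC : t ≤ C := by simpa [hL1] using hC L hL 1
    have hp : 0 < C + 1 + t := by positivity
    have hm : 0 < C + 1 - t := by linarith
    set B : A →ₗ[ℝ] ℝ := L ∘ₗ LinearMap.mulLeft ℝ (b ^ 2) with hB
    have hBa : ∀ x, B x = L (b ^ 2 * x) := fun x => rfl
    have hBs : ∀ c, 0 ≤ B (c ^ 2) := fun c => by
      rw [hBa, ← mul_pow]; exact hL.1 _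
    have hBq : ∀ c, B (q * c ^ 2) ≤ v * B (c ^ 2) := fun c => by
      have := hL.2 (b * c)
      rw [hBa, hBa, ← mul_pow, show b ^ 2 * (q * c ^ 2) = q * (b * c) ^ 2 by ring]
      exact this
    have h1 : ⇑((C + 1 + t)⁻¹ • ((C + 1) • L + B)) ∈ QS v q := by
      refine ⟨_, ⟨fun c => ?_, fun c => ?_⟩, ?_, rfl⟩
      · have := hBs c
        have := hL.1 c
        simp only [LinearMap.add_apply, LinearMap.smul_apply, smul_eq_mul]
        positivity
      · simp only [LinearMap.add_apply, LinearMap.smul_apply, smul_eq_mul]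
        rw [mul_left_comm]
        refine mul_le_mul_of_nonneg_left ?_ (by positivity)
        have := mul_le_mul_of_nonneg_left (hL.2 c) (by positivity : 0 ≤ C + 1)
        linarith [hBq c]
      · simp only [LinearMap.add_apply, LinearMap.smul_apply, smul_eq_mul, hBa, mul_one, hL1, ← ht]
        field_simp
    have h2 : ⇑((C + 1 - t)⁻¹ • ((C + 1) • L - B)) ∈ QS v q := by
      refine ⟨_, ⟨fun c => ?_, fun c => ?_⟩, ?_, rfl⟩
      · simp only [LinearMap.sub_apply, LinearMap.smul_apply, smul_eq_mul]
        refine mul_nonneg (by positivity) ?_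
        have := hC L hL c
        rw [hBa]
        linarith [hL.1 c]
      · simp only [LinearMap.sub_apply, LinearMap.smul_apply, smul_eq_mul]
        rw [mul_left_comm]
        refine mul_le_mul_of_nonneg_left ?_ (by positivity)
        have h3 := hC _ hL' c
        have h4 := hL'.1 c
        simp only [LinearMap.comp_apply, LinearMap.mulLeft_apply, sub_mul, map_sub, smul_mul_assoc,
          one_mul, map_smul, smul_eq_mul] at h3 h4
        rw [hBa, hBa, show b ^ 2 * (q * c ^ 2) = q * (b ^ 2 * c ^ 2) by ring]
        linarith
      · simp only [LinearMap.sub_apply, LinearMap.smul_apply, smul_eq_mul, hBa, mul_one, hL1, ← ht]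
        field_simp
    have h3 := hext h1 h2 ⟨(C + 1 + t) / (2 * (C + 1)), (C + 1 - t) / (2 * (C + 1)),
      by positivity, by positivity, by field_simp; ring, by
        ext x
        simp only [Pi.add_apply, Pi.smul_apply, LinearMap.sub_apply, LinearMap.add_apply,
          LinearMap.smul_apply, smul_eq_mul]
        field_simp
        ring⟩
    intro x
    have h4 := congrFun h3 x
    simp only [LinearMap.add_apply, LinearMap.smul_apply, smul_eq_mul, hBa] at h4
    rw [inv_mul_eq_iff_eq_mul₀ hp.ne'] at h4
    linarith
  have hmul : ∀ x y, L (x * y) = L x * L y := by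
    intro x y
    have e1 := key (x + 1) y
    have e2 := key x y
    have e3 : L ((x + 1) ^ 2 * y) = L (x ^ 2 * y) + L (x * y) + L (x * y) + L y := by
      simp only [← map_add]; congr 1; ring
    have e4 : L ((x + 1) ^ 2) = L (x ^ 2) + L x + L x + 1 := by
      rw [← hL1]; simp only [← map_add]; congr 1; ring
    rw [e3, e4] at e1
    linarith
  exact ⟨AlgHom.ofLinearMap L hL1 hmul, rfl⟩

/-- Restricting the Riesz measure to a smaller sigma-algebra. -/
lemma rmk_aux {X : Type*} [TopologicalSpace X] [CompactSpace X] [T2Space X] [m : MeasurableSpace X]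
    (hm : m ≤ borel X) (Λ : C(X, ℝ) →ₗ[ℝ] ℝ) (hΛ : ∀ g : C(X, ℝ), 0 ≤ g → 0 ≤ Λ g) :
    ∃ μ : Measure X, IsFiniteMeasure μ ∧
      ∀ g : C(X, ℝ), Measurable g → Λ g = ∫ x, g x ∂μ := by
  have main : ∃ μ : @Measure X (borel X), @IsFiniteMeasure X (borel X) μ ∧
      ∀ g : C(X, ℝ), Λ g = @integral X ℝ _ _ (borel X) μ g := by
    letI : MeasurableSpace X := borel X
    haveI : BorelSpace X := ⟨rfl⟩
    let T : CompactlySupportedContinuousMap X ℝ →ₗ[ℝ] ℝ :=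
      { toFun := fun f => Λ f.toContinuousMap
        map_add' := fun f g => by rw [← map_add]; rfl
        map_smul' := fun c f => by rw [RingHom.id_apply, ← map_smul]; rfl }
    refine ⟨RealRMK.rieszMeasure (PositiveLinearMap.mk₀ T fun f hf => hΛ _ hf), inferInstance,
      fun g => ?_⟩
    have := RealRMK.integral_rieszMeasure (PositiveLinearMap.mk₀ T fun f hf => hΛ _ hf)
      (CompactlySupportedContinuousMap.continuousMapEquiv g)
    exact this.symm
  obtain ⟨μ, hfin, hμ⟩ := main
  refine ⟨@Measure.trim X m (borel X) μ hm, isFiniteMeasure_trim hm, fun g hg => ?_⟩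
  rw [hμ g]
  exact integral_trim hm hg.stronglyMeasurable

lemma ext_aux (K : Set (A → ℝ)) (hK : IsCompact K) (hKc : K ⊆ charSet A) (L : A →ₗ[ℝ] ℝ)
    (hpos : ∀ x : A, (∀ φ ∈ K, 0 ≤ φ x) → 0 ≤ L x) :
    ∃ μ : Measure K, IsFiniteMeasure μ ∧ ∀ x : A, L x = ∫ φ, (φ : A → ℝ) x ∂μ := by
  haveI : CompactSpace K := isCompact_iff_compactSpace.1 hK
  have hKlin : ∀ φ : K, ∃ ψ : A →ₐ[ℝ] ℝ, ⇑ψ = (φ : A → ℝ) := fun φ => hKc φ.2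
  let ev : A →ₗ[ℝ] C(K, ℝ) :=
    { toFun := fun x => ⟨fun φ => (φ : A → ℝ) x, (continuous_apply x).comp continuous_subtype_val⟩
      map_add' := fun x y => by
        ext φ
        obtain ⟨ψ, hψ⟩ := hKlin φ
        simp [← hψ]
      map_smul' := fun c x => by
        ext φ
        obtain ⟨ψ, hψ⟩ := hKlin φ
        simp [← hψ] }
  have hev : ∀ x (φ : K), ev x φ = (φ : A → ℝ) x := fun _ _ => rfl
  let s : PointedCone ℝ (C(K, ℝ) × A) :=
    { carrier := {p | 0 ≤ p.1 + ev p.2}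
      add_mem' := fun {p q} hp hq => by
        have := add_nonneg (Set.mem_ofPred.1 hp) (Set.mem_ofPred.1 hq)
        simp only [Set.mem_ofPred_eq, Prod.fst_add, Prod.snd_add, map_add]
        convert this using 1
        abel
      zero_mem' := by simp
      smul_mem' := fun c p hp φ => by
        have h1 : 0 ≤ p.1 φ + ev p.2 φ := (Set.mem_ofPred.1 hp : 0 ≤ p.1 + ev p.2) φ
        have h2 := mul_nonneg c.2 h1
        rw [mul_add] at h2
        have e : ev (c • p).2 = (c : ℝ) • ev p.2 := by rw [← map_smul]; rfl
        rw [e]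
        exact h2 }
  have hs : ∀ p, p ∈ s ↔ 0 ≤ p.1 + ev p.2 := fun _ => Iff.rfl
  let f : (C(K, ℝ) × A) →ₗ.[ℝ] ℝ :=
    { domain := Submodule.prod ⊥ ⊤
      toFun := (L ∘ₗ LinearMap.snd ℝ C(K, ℝ) A) ∘ₗ Submodule.subtype _ }
  obtain ⟨G, hG1, hG2⟩ := riesz_extension s f (by
    rintro ⟨⟨g, x⟩, hg, hg2⟩ hx
    have hg : g = 0 := hg
    change 0 ≤ L x
    rw [hs] at hx
    refine hpos x fun φ hφ => ?_
    have h3 : 0 ≤ g ⟨φ, hφ⟩ + ev x ⟨φ, hφ⟩ := hx ⟨φ, hφ⟩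
    simpa [hev, hg] using h3) (by
    rintro ⟨g, x⟩
    refine ⟨⟨(0, algebraMap ℝ A ‖g + ev x‖), ⟨rfl, trivial⟩⟩, ?_⟩
    rw [hs]
    intro φ
    obtain ⟨ψ, hψ⟩ := hKlin φ
    have h1 := (g + ev x).norm_coe_le_norm φ
    have h2 := neg_abs_le ((g + ev x) φ)
    rw [Real.norm_eq_abs] at h1
    have h3 : ev (algebraMap ℝ A ‖g + ev x‖) φ = ‖g + ev x‖ := by
      rw [hev, ← hψ]; simp
    simp only [Prod.mk_add_mk, zero_add, map_add]
    change 0 ≤ g φ + (ev (algebraMap ℝ A ‖g + ev x‖) φ + ev x φ)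
    rw [h3]
    simp only [ContinuousMap.add_apply] at h1 h2
    linarith)
  have hGL : ∀ x, G (0, x) = L x := fun x => hG1 ⟨(0, x), ⟨rfl, trivial⟩⟩
  have hGe : ∀ x, G (ev x, 0) = L x := by
    intro x
    have h1 := hG2 (ev x, -x) (by rw [hs]; simp)
    have h2 := hG2 (-ev x, x) (by rw [hs]; simp)
    have e1 : ((ev x, -x) : C(K, ℝ) × A) = (ev x, 0) - (0, x) := by simp
    have e2 : ((-ev x, x) : C(K, ℝ) × A) = (0, x) - (ev x, 0) := by simp
    rw [e1, map_sub, hGL] at h1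
    rw [e2, map_sub, hGL] at h2
    linarith
  obtain ⟨μ, hfin, hμ⟩ := rmk_aux (X := K) (by
      refine MeasurableSpace.comap_le_iff_le_map.2 ?_
      refine iSup_le fun x => MeasurableSpace.comap_le_iff_le_map.2 ?_
      intro t ht
      have hc : Continuous (fun φ : K => (φ : A → ℝ) x) :=
        (continuous_apply x).comp continuous_subtype_val
      exact hc.borel_measurable ht)
    (G ∘ₗ LinearMap.inl ℝ C(K, ℝ) A) (fun g hg => hG2 (g, 0) (by rw [hs]; simpa using hg))
  refine ⟨μ, hfin, fun x => ?_⟩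
  rw [← hGe x]
  exact hμ (ev x) ((measurable_pi_apply x).comp measurable_subtype_coe)

lemma forward_aux (L : A →ₗ[ℝ] ℝ) (a : A) (hpsd : ∀ x : A, 0 ≤ L (x ^ 2))
    (K : Set (A → ℝ)) (hKc : K ⊆ charSet A) (hK : IsCompact K)
    (μ : Measure K) [IsFiniteMeasure μ] (hμ : ∀ x : A, L x = ∫ φ, (φ : A → ℝ) x ∂μ) :
    BddAbove (ratioSet L a) := by
  have hbd : ∀ x : A, ∃ M : ℝ, ∀ φ ∈ K, ‖φ x‖ ≤ M := fun x =>
    hK.exists_bound_of_continuousOn (f := fun φ : A → ℝ => φ x) (by fun_prop)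
  have hint : ∀ x : A, Integrable (fun φ : K => (φ : A → ℝ) x) μ := by
    intro x
    obtain ⟨M, hM⟩ := hbd x
    exact Integrable.of_bound
      ((measurable_pi_apply x).comp measurable_subtype_coe).aestronglyMeasurable M
      (Filter.Eventually.of_forall fun φ => hM φ φ.2)
  obtain ⟨M, hM⟩ := hbd (a ^ 2)
  refine ⟨M, ?_⟩
  rintro r ⟨n, hn, rfl⟩
  have hn0 : 0 ≤ L (a ^ (2 * n)) := by
    have := hpsd (a ^ n); rwa [← pow_mul, mul_comm] at this
  rw [div_le_iff₀ (lt_of_le_of_ne hn0 (Ne.symm hn)), hμ, hμ, ← integral_const_mul]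
  refine integral_mono (hint _) ((hint _).const_mul M) fun φ => ?_
  obtain ⟨ψ, hψ⟩ := hKc φ.2
  have h1 := hM φ φ.2
  simp only [← hψ, map_pow] at h1 ⊢
  have h2 : ψ a ^ 2 ≤ M := (le_abs_self _).trans h1
  rw [pow_add, mul_comm]
  exact mul_le_mul_of_nonneg_right h2 (by rw [pow_mul]; positivity)

theorem stmt16 (hX : Nonempty (A →ₐ[ℝ] ℝ)) (m : ℕ) (a : Fin m → A)
    (hgen : Algebra.adjoin ℝ (Set.range a) = ⊤)
    (L : A →ₗ[ℝ] ℝ) (hpsd : ∀ x : A, 0 ≤ L (x ^ 2)) (h1 : L 1 = 1) :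
    ((∃ K : Set (A → ℝ), K ⊆ charSet A ∧ IsCompact K ∧
        ∃ μ : Measure K, IsFiniteMeasure μ ∧ ∀ x : A, L x = ∫ φ, (φ : A → ℝ) x ∂μ) ↔
      BddAbove (ratioSet L (∑ i, a i ^ 2))) ∧
    (BddAbove (ratioSet L (∑ i, a i ^ 2)) →
      ∃ K : Set (A → ℝ), K ⊆ charSet A ∧ IsCompact K ∧
        K ⊆ {φ : A → ℝ | ∑ i, |φ (a i)| ^ 2 ≤ vL L (∑ i, a i ^ 2)} ∧
        ∃ μ : Measure K, IsFiniteMeasure μ ∧ ∀ x : A, L x = ∫ φ, (φ : A → ℝ) x ∂μ) := by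
  have main : BddAbove (ratioSet L (∑ i, a i ^ 2)) →
      ∃ K : Set (A → ℝ), K ⊆ charSet A ∧ IsCompact K ∧
        K ⊆ {φ : A → ℝ | ∑ i, |φ (a i)| ^ 2 ≤ vL L (∑ i, a i ^ 2)} ∧
        ∃ μ : Measure K, IsFiniteMeasure μ ∧ ∀ x : A, L x = ∫ φ, (φ : A → ℝ) x ∂μ := by
    intro hb
    set v := vL L (∑ i, a i ^ 2) with hv
    have hv0 : 0 ≤ v := Real.sqrt_nonneg _
    have hLQ : L ∈ QM v (∑ i, a i ^ 2) :=
      ⟨hpsd, mod_bound L hpsd _ v hv0 (pow_bound L hpsd h1 _ hb)⟩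
    have hLS : ⇑L ∈ QS v (∑ i, a i ^ 2) := ⟨L, hLQ, h1, rfl⟩
    have hcomp := QS_compact a hgen v
    let K : Set (A → ℝ) := QS v (∑ i, a i ^ 2) ∩ {f | ∀ x y, f (x * y) = f x * f y}
    have hKc : K ⊆ charSet A := by
      rintro f ⟨⟨M, hM, hM1, rfl⟩, hmul⟩
      exact ⟨AlgHom.ofLinearMap M hM1 hmul, rfl⟩
    have hcl : IsClosed {f : A → ℝ | ∀ x y, f (x * y) = f x * f y} := by
      simp only [Set.ofPred_forall]
      exact isClosed_iInter fun x => isClosed_iInter fun y =>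
        isClosed_eq (by fun_prop) (by fun_prop)
    have hKcomp : IsCompact K := hcomp.inter_right hcl
    have hext : (QS v (∑ i, a i ^ 2)).extremePoints ℝ ⊆ K := by
      intro f hf
      refine ⟨hf.1, ?_⟩
      obtain ⟨ψ, rfl⟩ := QS_extreme a hgen v f hf
      exact map_mul ψ
    refine ⟨K, hKc, hKcomp, ?_, ext_aux K hKcomp hKc L ?_⟩
    · intro f hf
      obtain ⟨ψ, rfl⟩ := hKc hf
      obtain ⟨⟨M, hM, hM1, hMψ⟩, -⟩ := hf
      have := hM.2 1
      rw [hMψ] at this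
      simpa using this
    · intro x hx
      have hsub : closure (convexHull ℝ ((QS v (∑ i, a i ^ 2)).extremePoints ℝ)) ⊆
          {f : A → ℝ | 0 ≤ f x} := by
        refine closure_minimal (convexHull_min (fun f hf => hx f (hext hf)) ?_)
          (isClosed_le (by fun_prop) (by fun_prop))
        intro f hf g hg s t hs ht _
        exact add_nonneg (mul_nonneg hs hf) (mul_nonneg ht hg)
      rw [closure_convexHull_extremePoints hcomp (QS_convex _ _)] at hsub
      exact hsub hLS
  refine ⟨⟨?_, fun hb => ?_⟩, main⟩
  · rintro ⟨K, hKc, hK, μ, hfin, hμ⟩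
    exact forward_aux L _ hpsd K hKc hK μ hμ
  · obtain ⟨K, hKc, hK, -, h⟩ := main hb
    exact ⟨K, hKc, hK, h⟩
end
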